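/- arXiv:2101.09205 — 11 statements merged into one kernel-verified Lean document; each statement's English description precedes it below -/
import Mathlib

section
/- Let the circle group act continuously on a T1 topological space X, and let x ∈ X be a point that is not fixed by the whole circle group (i.e. there exists u with u • x ≠ x). Then the stabilizer of x is a finite subgroup of the circle group; in other words, a continuous circle action is locally free on the complement of its fixed-point set. -/
/-- A subgroup of the circle group is dense or finite. -/
theorem Subgroup.dense_or_finite_circle (S : Subgroup Circle) :
    Dense (S : Set Circle) ∨ (S : Set Circle).Finite := by
  have : Fact (0 < (1 : ℝ)) := ⟨one_pos⟩
  let e := AddCircle.homeomorphCircle (T := 1) one_ne_zero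
  have he (a : AddCircle (1 : ℝ)) : e a = a.toCircle := AddCircle.homeomorphCircle_apply _ a
  let T : AddSubgroup (AddCircle (1 : ℝ)) :=
    { carrier := e ⁻¹' S
      zero_mem' := by simp [he, S.one_mem]
      add_mem' := fun ha hb => by
        simp only [Set.mem_preimage, he, SetLike.mem_coe, AddCircle.toCircle_add] at ha hb ⊢
        exact S.mul_mem ha hb
      neg_mem' := fun ha => by
        simp only [Set.mem_preimage, he, SetLike.mem_coe, AddCircle.toCircle_neg] at ha ⊢
        exact S.inv_mem ha }
  have hST : e '' (T : Set (AddCircle (1 : ℝ))) = S := e.surjective.image_preimage _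
  rw [← hST]
  by_cases hT : Dense (T : Set (AddCircle (1 : ℝ)))
  · exact .inl (e.surjective.denseRange.dense_image e.continuous hT)
  · rw [AddCircle.dense_addSubgroup_iff_ne_zmultiples] at hT
    push Not at hT
    obtain ⟨a, ha, hTa⟩ := hT
    rw [hTa]
    refine .inr (Set.Finite.image _ ?_)
    rw [← Set.finite_coe_iff]
    exact finite_zmultiples.2 (addOrderOf_ne_zero_iff.1 ha)

/-- A continuous circle action on a T1 space is locally free away from its fixed-point set:
the stabilizer of any point that is not fixed by the whole circle group is finite. -/
theorem circle_action_stabilizer_finite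
    {X : Type*} [TopologicalSpace X] [T1Space X] [MulAction Circle X]
    (hcont : ∀ x : X, Continuous fun u : Circle => u • x)
    (x : X) (hx : ∃ u : Circle, u • x ≠ x) :
    Set.Finite (MulAction.stabilizer Circle x : Set Circle) := by
  have hclosed : IsClosed (MulAction.stabilizer Circle x : Set Circle) :=
    isClosed_singleton.preimage (hcont x)
  refine (Subgroup.dense_or_finite_circle _).resolve_left fun hdense => ?_
  obtain ⟨u, hu⟩ := hx
  exact hu (hclosed.closure_subset (hdense u))
end

section
/- The unit sphere of an infinite-dimensional real Hilbert space is contractible: if H is a complete real inner product space that is not finite-dimensional, then the subspace {x ∈ H : ‖x‖ = 1} is a contractible topological space. -/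
open scoped InnerProductSpace

/-- Two maps into the unit sphere that are joined by segments avoiding the origin are homotopic. -/
lemma homotopic_sphere_of_segment_ne_zero {X E : Type*} [TopologicalSpace X]
    [NormedAddCommGroup E] [NormedSpace ℝ E] (f g : C(X, Metric.sphere (0 : E) 1))
    (hfg : ∀ (t : unitInterval) (x : X), (1 - (t : ℝ)) • (f x : E) + (t : ℝ) • (g x : E) ≠ 0) :
    f.Homotopic g := by
  let L : unitInterval × X → E := fun p =>
    (1 - (p.1 : ℝ)) • (f p.2 : E) + (p.1 : ℝ) • (g p.2 : E)
  have hL : Continuous L := by fun_prop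
  have hL0 : ∀ p, ‖L p‖ ≠ 0 := fun p => norm_ne_zero_iff.2 (hfg p.1 p.2)
  refine ⟨⟨⟨fun p => ⟨‖L p‖⁻¹ • L p, ?_⟩, ?_⟩, fun x => ?_, fun x => ?_⟩⟩
  · rw [mem_sphere_zero_iff_norm, norm_smul, norm_inv, norm_norm, inv_mul_cancel₀ (hL0 p)]
  · exact Continuous.subtype_mk ((hL.norm.inv₀ hL0).smul hL) _
  · ext
    simp [L]
  · ext
    simp [L]

/-- A Hilbert basis indexed by an infinite type gives rise to an isometric shift of infinite
multiplicity: its range is orthogonal to some unit vector and it has no nonzero eigenvectors. -/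
lemma HilbertBasis.exists_shift {ι H : Type*} [NormedAddCommGroup H] [InnerProductSpace ℝ H]
    [CompleteSpace H] [Infinite ι] (b : HilbertBasis ι ℝ H) :
    ∃ (S : H →ₗᵢ[ℝ] H) (e : H), ‖e‖ = 1 ∧ (∀ x, ⟪e, S x⟫_ℝ = 0) ∧
      ∀ (x : H) (a c : ℝ), a ≠ 0 → a • x + c • S x = 0 → x = 0 := by
  classical
  obtain ⟨φ⟩ : Nonempty (ι × ℕ ≃ ι) := by
    rw [← Cardinal.lift_mk_eq']
    simp [Cardinal.mul_aleph0_eq]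
  let s : ι → ι := fun j => φ ((φ.symm j).1, (φ.symm j).2 + 1)
  have hs : Function.Injective s := fun j k hjk => by
    have := φ.injective hjk
    simp only [Prod.mk.injEq, Nat.add_right_cancel_iff] at this
    exact φ.symm.injective (Prod.ext this.1 this.2)
  have hv : Orthonormal ℝ (b ∘ s) := b.orthonormal.comp s hs
  let S : H →ₗᵢ[ℝ] H :=
    hv.orthogonalFamily.linearIsometry.comp b.repr.toLinearIsometry
  have hSb : ∀ j, S (b j) = b (s j) := fun j => by
    change hv.orthogonalFamily.linearIsometry (b.repr (b j)) = b (s j)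
    rw [b.repr_self, OrthogonalFamily.linearIsometry_apply_single]
    simp
  have hsum : ∀ x k, HasSum (fun j => b.repr x j * ⟪b k, b (s j)⟫_ℝ) ⟪b k, S x⟫_ℝ := fun x k => by
    have := ((b.hasSum_repr x).mapL S.toContinuousLinearMap).mapL (innerSL ℝ (b k))
    simpa [hSb, inner_smul_right] using this
  have hortho := orthonormal_iff_ite.1 b.orthonormal
  have hzero : ∀ x i, ⟪b (φ (i, 0)), S x⟫_ℝ = 0 := fun x i => by
    refine (hsum x _).unique ?_
    convert hasSum_zero with j
    simp [hortho, s]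
  have hsucc : ∀ x i n, ⟪b (φ (i, n + 1)), S x⟫_ℝ = ⟪b (φ (i, n)), x⟫_ℝ := fun x i n => by
    refine (hsum x _).unique ?_
    convert hasSum_single (φ (i, n)) fun j hj => ?_ using 1
    · simp [s, b.repr_apply_apply, b.orthonormal.1]
    · have : φ (i, n + 1) ≠ s j := fun h => hj (hs (by rw [← h]; simp [s]))
      simp [hortho, this]
  obtain ⟨i₀⟩ := (inferInstance : Nonempty ι)
  refine ⟨S, b (φ (i₀, 0)), b.orthonormal.1 _, fun x => hzero x i₀, fun x a c ha hx => ?_⟩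
  have hcoord : ∀ k, a * ⟪b k, x⟫_ℝ + c * ⟪b k, S x⟫_ℝ = 0 := fun k => by
    simpa [inner_add_right, inner_smul_right] using congrArg (fun y => ⟪b k, y⟫_ℝ) hx
  have hx0 : ∀ n i, ⟪b (φ (i, n)), x⟫_ℝ = 0 := by
    intro n
    induction n with
    | zero => intro i; simpa [hzero, ha] using hcoord (φ (i, 0))
    | succ n ih => intro i; simpa [hsucc, ih, ha] using hcoord (φ (i, n + 1))
  refine (map_eq_zero_iff b.repr b.repr.injective).1 (lp.ext (funext fun k => ?_))
  simpa [b.repr_apply_apply] using hx0 (φ.symm k).2 (φ.symm k).1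

/-- The unit sphere of an infinite-dimensional real Hilbert space is contractible. -/
theorem sphere_contractible_of_infinite_dimensional_hilbert
    {H : Type*} [NormedAddCommGroup H] [InnerProductSpace ℝ H] [CompleteSpace H]
    (h : ¬FiniteDimensional ℝ H) :
    ContractibleSpace (Metric.sphere (0 : H) 1) := by
  obtain ⟨w, b, -⟩ := exists_hilbertBasis ℝ H
  have : Infinite w := by
    refine not_finite_iff_infinite.1 fun hw => h ?_
    have := Fintype.ofFinite w
    exact b.toOrthonormalBasis.toBasis.finiteDimensional_of_finite
  obtain ⟨S, e, he, hperp, heig⟩ := b.exists_shift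
  have hne : ∀ x : Metric.sphere (0 : H) 1, (x : H) ≠ 0 := fun x =>
    ne_zero_of_mem_unit_sphere x
  let shift : C(Metric.sphere (0 : H) 1, Metric.sphere (0 : H) 1) :=
    ⟨fun x => ⟨S x, by simp⟩, by fun_prop⟩
  let pole : Metric.sphere (0 : H) 1 := ⟨e, by simp [he]⟩
  rw [contractible_iff_id_nullhomotopic]
  refine ⟨pole, (homotopic_sphere_of_segment_ne_zero _ shift fun t x h0 => ?_).trans
    (homotopic_sphere_of_segment_ne_zero shift _ fun t x h0 => ?_)⟩
  · by_cases ht : (1 - (t : ℝ)) = 0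
    · have ht' : (t : ℝ) = 1 := by linarith
      exact hne (shift x) (by simpa [ht'] using h0)
    · exact hne x (heig x _ _ ht h0)
  · have ht : (t : ℝ) = 0 := by
      simpa [shift, pole, inner_add_right, inner_smul_right, hperp, he] using
        congrArg (fun y => ⟪e, y⟫_ℝ) h0
    exact hne (shift x) (by simpa [ht] using h0)
end

section
/- For every n ∈ ℕ and every c ∈ ℝ, ∫_ℝ H_n(x)² e^{−(x−c)²} dx = 2ⁿ · n! · √π · ∑_{k=0}^{n} (binomial n k) · (2c²)^k / k!; that is, ∫_ℝ H_n(x)² e^{−(x−c)²} dx = 2ⁿ n! √π · L_n(−2c²). -/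
/-- The nth physicists' Hermite polynomial, `H_n(x) = 2^(n/2) * He_n(√2 * x)`, where
`He_n` is the probabilists' Hermite polynomial. -/
noncomputable def physHermite (n : ℕ) (x : ℝ) : ℝ :=
  (2 : ℝ) ^ ((n : ℝ) / 2) * Polynomial.aeval (Real.sqrt 2 * x) (Polynomial.hermite n)

open Polynomial MeasureTheory

/-- The probabilists' Hermite polynomials form an Appell sequence. -/
theorem derivative_hermite_succ (n : ℕ) :
    derivative (hermite (n + 1)) = (n + 1 : ℤ[X]) * hermite n := by
  induction n with
  | zero => simp
  | succ n ih =>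
    have h := hermite_succ (n + 1)
    rw [ih] at h
    have hd := congrArg derivative h
    rw [hd]
    have h' := hermite_succ n
    simp only [derivative_sub, derivative_mul, derivative_X, ih, derivative_add,
      derivative_natCast, derivative_one]
    push_cast
    linear_combination (-(n : ℤ[X]) - 1) * h'

theorem integrable_pow_mul_gaussian (n : ℕ) :
    Integrable fun y : ℝ => y ^ n * Real.exp (-(1 / 2) * y ^ 2) := by
  have h := integrable_rpow_mul_exp_neg_mul_sq (b := 1 / 2) (by norm_num) (s := n)
    (by have := n.cast_nonneg (α := ℝ); linarith)
  simpa only [Real.rpow_natCast] using h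

theorem integrable_eval_mul_gaussian (p : ℝ[X]) :
    Integrable fun y : ℝ => p.eval y * Real.exp (-(1 / 2) * y ^ 2) := by
  induction p using Polynomial.induction_on' with
  | add p q hp hq =>
    simp only [eval_add, add_mul]
    exact hp.add hq
  | monomial n a =>
    simpa only [eval_monomial, mul_assoc] using (integrable_pow_mul_gaussian n).const_mul a

theorem integrable_eval_mul_shifted_gaussian (s : ℝ) (p : ℝ[X]) :
    Integrable fun y : ℝ => p.eval y * Real.exp (-(1 / 2) * (y - s) ^ 2) := by
  have h := (integrable_eval_mul_gaussian (p.comp (X + C s))).comp_sub_right s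
  simpa using h

/-- The integral of a polynomial against the unnormalised Gaussian weight centred at `s`. -/
noncomputable def gaussianMoment (s : ℝ) (p : ℝ[X]) : ℝ :=
  ∫ y : ℝ, p.eval y * Real.exp (-(1 / 2) * (y - s) ^ 2)

theorem gaussianMoment_add (s : ℝ) (p q : ℝ[X]) :
    gaussianMoment s (p + q) = gaussianMoment s p + gaussianMoment s q := by
  simp only [gaussianMoment, eval_add, add_mul]
  exact integral_add (integrable_eval_mul_shifted_gaussian s p)
    (integrable_eval_mul_shifted_gaussian s q)

theorem gaussianMoment_C_mul (s a : ℝ) (p : ℝ[X]) :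
    gaussianMoment s (C a * p) = a * gaussianMoment s p := by
  simp only [gaussianMoment, eval_mul, eval_C, mul_assoc, integral_const_mul]

theorem gaussianMoment_one (s : ℝ) : gaussianMoment s 1 = √(2 * Real.pi) := by
  simp only [gaussianMoment, eval_one, one_mul]
  rw [integral_sub_right_eq_self (fun y : ℝ => Real.exp (-(1 / 2) * y ^ 2)) s, integral_gaussian]
  congr 1
  ring

/-- Integration by parts against the Gaussian weight. -/
theorem gaussianMoment_X_mul (s : ℝ) (p : ℝ[X]) :
    gaussianMoment s (X * p) = s * gaussianMoment s p + gaussianMoment s (derivative p) := by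
  have hzero : gaussianMoment s (derivative p + C (-1) * ((X - C s) * p)) = 0 := by
    refine integral_eq_zero_of_hasDerivAt_of_integrable
      (f := fun y => p.eval y * Real.exp (-(1 / 2) * (y - s) ^ 2)) (fun y => ?_)
      (integrable_eval_mul_shifted_gaussian s _) (integrable_eval_mul_shifted_gaussian s p)
    have hw : HasDerivAt (fun y : ℝ => -(1 / 2) * (y - s) ^ 2) (-(y - s)) y := by
      refine ((((hasDerivAt_id y).sub_const s).pow 2).const_mul (-(1 / 2) : ℝ)).congr_deriv ?_
      simp
    refine ((p.hasDerivAt y).mul hw.exp).congr_deriv ?_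
    simp
    ring
  have hX : X * p = C s * p + (derivative p + C (-1) *
      (derivative p + C (-1) * ((X - C s) * p))) := by
    simp only [map_neg, map_one]
    ring
  rw [hX, gaussianMoment_add, gaussianMoment_add, gaussianMoment_C_mul, gaussianMoment_C_mul,
    hzero, mul_zero, add_zero]

/-- The mixed second moments of the Hermite polynomials under a shifted Gaussian weight. -/
noncomputable def hermiteMoment (s : ℝ) (m n : ℕ) : ℝ :=
  gaussianMoment s ((hermite m).map (Int.castRingHom ℝ) * (hermite n).map (Int.castRingHom ℝ))

theorem hermiteMoment_comm (s : ℝ) (m n : ℕ) : hermiteMoment s m n = hermiteMoment s n m := by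
  rw [hermiteMoment, mul_comm, hermiteMoment]

theorem hermiteMoment_succ_right (s : ℝ) (m n : ℕ) :
    hermiteMoment s m (n + 1) = s * hermiteMoment s m n +
      gaussianMoment s (derivative ((hermite m).map (Int.castRingHom ℝ)) *
        (hermite n).map (Int.castRingHom ℝ)) := by
  simp only [hermiteMoment]
  set P := (hermite m).map (Int.castRingHom ℝ)
  set Q := (hermite n).map (Int.castRingHom ℝ) with hQ
  have h : (hermite (n + 1)).map (Int.castRingHom ℝ) = X * Q - derivative Q := by
    simp [hermite_succ, hQ, derivative_map]
  have hPQ : P * (X * Q - derivative Q) = X * (P * Q) + C (-1) * (P * derivative Q) := by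
    simp only [map_neg, map_one]
    ring
  rw [h, hPQ, gaussianMoment_add, gaussianMoment_X_mul, gaussianMoment_C_mul, derivative_mul,
    gaussianMoment_add]
  ring

theorem hermiteMoment_zero_succ (s : ℝ) (n : ℕ) :
    hermiteMoment s 0 (n + 1) = s * hermiteMoment s 0 n := by
  rw [hermiteMoment_succ_right]
  simp [gaussianMoment]

theorem hermiteMoment_succ_succ (s : ℝ) (m n : ℕ) :
    hermiteMoment s (m + 1) (n + 1) =
      s * hermiteMoment s (m + 1) n + (m + 1) * hermiteMoment s m n := by
  rw [hermiteMoment_succ_right, derivative_map, derivative_hermite_succ]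
  have h : ((m + 1 : ℤ[X]) * hermite m).map (Int.castRingHom ℝ) =
      C (m + 1 : ℝ) * (hermite m).map (Int.castRingHom ℝ) := by
    simp [Polynomial.map_mul]
  rw [h, mul_assoc, gaussianMoment_C_mul, hermiteMoment, hermiteMoment]

theorem hermiteMoment_zero_left (s : ℝ) (n : ℕ) :
    hermiteMoment s 0 n = √(2 * Real.pi) * s ^ n := by
  induction n with
  | zero => simpa [hermiteMoment] using gaussianMoment_one s
  | succ n ih => rw [hermiteMoment_zero_succ, ih]; ring

theorem hermiteMoment_eq_sum (s : ℝ) (m n : ℕ) :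
    hermiteMoment s m n = √(2 * Real.pi) * ∑ k ∈ Finset.range (m + 1),
      (k.factorial : ℝ) * m.choose k * n.choose k * (s ^ (m - k) * s ^ (n - k)) := by
  induction n generalizing m with
  | zero =>
    rw [hermiteMoment_comm, hermiteMoment_zero_left, Finset.sum_range_succ']
    simp
  | succ n ih =>
    cases m with
    | zero => simp [hermiteMoment_zero_left]
    | succ m =>
      rw [hermiteMoment_succ_succ, ih, ih, mul_left_comm s, mul_left_comm (m + 1 : ℝ),
        ← mul_add]
      congr 1
      rw [Finset.sum_range_succ' _ (m + 1), Finset.sum_range_succ' _ (m + 1), mul_add,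
        add_right_comm, Finset.mul_sum, Finset.mul_sum, ← Finset.sum_add_distrib]
      congr 1
      · refine Finset.sum_congr rfl fun k _ => ?_
        have hm : ((m + 1 : ℕ) : ℝ) * m.choose k = (m + 1).choose (k + 1) * (k + 1 : ℕ) := by
          exact_mod_cast Nat.add_one_mul_choose_eq m k
        have hs : s * ((n.choose (k + 1) : ℝ) * s ^ (n - (k + 1))) =
            n.choose (k + 1) * s ^ (n - k) := by
          rcases Nat.lt_or_ge n (k + 1) with h | h
          · simp [Nat.choose_eq_zero_of_lt h]
          · rw [show n - k = n - (k + 1) + 1 by omega]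
            ring
        rw [Nat.choose_succ_succ n k, Nat.factorial_succ, Nat.add_sub_add_right,
          Nat.add_sub_add_right]
        push_cast at hm ⊢
        linear_combination
          ((k : ℝ) + 1) * k.factorial * (m + 1).choose (k + 1) * s ^ (m - k) * hs +
            k.factorial * n.choose k * s ^ (m - k) * s ^ (n - k) * hm
      · simp
        ring

theorem hermiteMoment_self (s : ℝ) (n : ℕ) :
    hermiteMoment s n n = √(2 * Real.pi) * (n.factorial *
      ∑ k ∈ Finset.range (n + 1), (n.choose k : ℝ) * (s ^ 2) ^ k / k.factorial) := by
  rw [hermiteMoment_eq_sum, ← Finset.sum_range_reflect (fun k => (k.factorial : ℝ) *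
    n.choose k * n.choose k * (s ^ (n - k) * s ^ (n - k)))]
  congr 1
  rw [Finset.mul_sum]
  refine Finset.sum_congr rfl fun k hk => ?_
  have hk' : k ≤ n := by simpa [Nat.lt_succ_iff] using hk
  have hf : (n.choose k : ℝ) * k.factorial * (n - k).factorial = n.factorial := by
    exact_mod_cast Nat.choose_mul_factorial_mul_factorial hk'
  have hk0 : (k.factorial : ℝ) ≠ 0 := by exact_mod_cast k.factorial_ne_zero
  rw [show n + 1 - 1 - k = n - k by omega, Nat.sub_sub_self hk', Nat.choose_symm hk', ← hf]
  field_simp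
  ring

/-- `∫ H_n(x)² e^{-(x-c)²} dx = 2ⁿ n! √π L_n(-2c²)`, with the Laguerre polynomial value
`L_n(-y) = ∑_{k=0}^n (n choose k) y^k / k!`. -/
theorem hermite_sq_shifted_gaussian_integral (n : ℕ) (c : ℝ) :
    ∫ x : ℝ, physHermite n x ^ 2 * Real.exp (-(x - c) ^ 2)
      = 2 ^ n * (n.factorial : ℝ) * Real.sqrt Real.pi *
          ∑ k ∈ Finset.range (n + 1),
            (n.choose k : ℝ) * (2 * c ^ 2) ^ k / (k.factorial : ℝ) := by
  have h2 : √2 ^ 2 = (2 : ℝ) := Real.sq_sqrt (by norm_num)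
  have hpow : ((2 : ℝ) ^ ((n : ℝ) / 2)) ^ 2 = 2 ^ n := by
    rw [← Real.rpow_natCast, ← Real.rpow_mul (by norm_num), ← Real.rpow_natCast]
    congr 1
    push_cast
    ring
  have hintegrand (x : ℝ) : physHermite n x ^ 2 * Real.exp (-(x - c) ^ 2) =
      2 ^ n * (fun y : ℝ => ((hermite n).map (Int.castRingHom ℝ) *
        (hermite n).map (Int.castRingHom ℝ)).eval y *
          Real.exp (-(1 / 2) * (y - √2 * c) ^ 2)) (√2 * x) := by
    have he : -(1 / 2) * (√2 * x - √2 * c) ^ 2 = -(x - c) ^ 2 := by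
      linear_combination (-(1 / 2) * (x - c) ^ 2) * h2
    simp only [he, physHermite, eval_mul, mul_pow, hpow, aeval_def, eval_map,
      algebraMap_int_eq]
    ring
  have hmoment := hermiteMoment_self (√2 * c) n
  rw [hermiteMoment, gaussianMoment] at hmoment
  rw [integral_congr_ae (ae_of_all _ hintegrand), integral_const_mul,
    Measure.integral_comp_mul_left (fun y : ℝ => ((hermite n).map (Int.castRingHom ℝ) *
      (hermite n).map (Int.castRingHom ℝ)).eval y * Real.exp (-(1 / 2) * (y - √2 * c) ^ 2)), hmoment, mul_pow, h2, smul_eq_mul,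
    abs_of_pos (by positivity), Real.sqrt_mul (by norm_num)]
  field_simp
end

section
/- For every integer N ≥ 1, ∫_{ℝ^N} Δ(λ)² · exp(−∑_{i=1}^N λ_i²) dλ = N! · π^{N/2} · 2^{−N(N−1)/2} · ∏_{k=0}^{N−1} k!. -/
open MeasureTheory

namespace GaussianMatrixModel

open Polynomial

/-- Andréief's identity. -/
theorem integral_det_mul_det {α : Type*} [MeasureSpace α] [SigmaFinite (volume : Measure α)]
    {n : ℕ} (f g : Fin n → α → ℝ) (hfg : ∀ i j, Integrable fun x => f i x * g j x) :
    ∫ l : Fin n → α, (Matrix.of fun i j => f i (l j)).det * (Matrix.of fun i j => g i (l j)).det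
      = n.factorial * (Matrix.of fun i j => ∫ x, f i x * g j x).det := by
  set M : Matrix (Fin n) (Fin n) ℝ := Matrix.of fun i j => ∫ x, f i x * g j x with hM
  have expand (l : Fin n → α) :
      (Matrix.of fun i j => f i (l j)).det * (Matrix.of fun i j => g i (l j)).det =
        ∑ σ : Equiv.Perm (Fin n), ∑ τ : Equiv.Perm (Fin n),
          (((σ.sign : ℤ) : ℝ) * ((τ.sign : ℤ) : ℝ)) * ∏ i, f (σ i) (l i) * g (τ i) (l i) := by
    simp only [Matrix.det_apply', Matrix.of_apply, Finset.sum_mul_sum, Finset.prod_mul_distrib]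
    exact Finset.sum_congr rfl fun _ _ => Finset.sum_congr rfl fun _ _ => by ring
  have integrable (σ τ : Equiv.Perm (Fin n)) : Integrable fun l : Fin n → α =>
      (((σ.sign : ℤ) : ℝ) * ((τ.sign : ℤ) : ℝ)) * ∏ i, f (σ i) (l i) * g (τ i) (l i) :=
    (Integrable.fintype_prod (f := fun i x => f (σ i) x * g (τ i) x)
      fun i => hfg (σ i) (τ i)).const_mul _
  have inner (σ : Equiv.Perm (Fin n)) : ∑ τ : Equiv.Perm (Fin n),
      (((σ.sign : ℤ) : ℝ) * ((τ.sign : ℤ) : ℝ)) * ∏ i, M (σ i) (τ i) = M.det := by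
    have key := Matrix.det_permute σ M
    rw [← Matrix.det_transpose, Matrix.det_apply'] at key
    simp only [Matrix.transpose_apply, Matrix.submatrix_apply, id] at key
    simp only [mul_assoc, ← Finset.mul_sum]
    rw [key, ← mul_assoc, ← Int.cast_mul, ← Units.val_mul, Int.units_mul_self]
    simp
  simp_rw [expand]
  rw [integral_finsetSum _ fun σ _ => integrable_finsetSum _ fun τ _ => integrable σ τ]
  simp_rw [integral_finsetSum _ fun τ _ => integrable _ τ, integral_const_mul]
  have fubini (σ τ : Equiv.Perm (Fin n)) :
      ∫ l : Fin n → α, ∏ i, f (σ i) (l i) * g (τ i) (l i) = ∏ i, M (σ i) (τ i) :=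
    integral_fintype_prod_volume_eq_prod fun i x => f (σ i) x * g (τ i) x
  simp_rw [fubini, inner]
  simp [Fintype.card_perm]

/-- Monic Hermite polynomials, orthogonal with respect to the weight `exp (-x ^ 2)`. -/
noncomputable def monicHermite : ℕ → ℝ[X]
  | 0 => 1
  | n + 1 => X * monicHermite n - C (1 / 2) * derivative (monicHermite n)

theorem monicHermite_spec (n : ℕ) :
    (monicHermite n).Monic ∧ (monicHermite n).natDegree = n := by
  induction n with
  | zero => simp [monicHermite]
  | succ n ih =>
    obtain ⟨hm, hd⟩ := ih
    have hX : (X * monicHermite n).Monic := monic_X.mul hm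
    have hXd : (X * monicHermite n).natDegree = n + 1 := by
      rw [natDegree_X_mul hm.ne_zero, hd]
    have hlt : (C (1 / 2 : ℝ) * derivative (monicHermite n)).degree
        < (X * monicHermite n).degree := by
      rw [degree_C_mul (by norm_num)]
      refine (degree_derivative_lt hm.ne_zero).trans_le ?_
      rw [degree_eq_natDegree hm.ne_zero, degree_eq_natDegree hX.ne_zero, hXd, hd]
      exact_mod_cast n.le_succ
    rw [monicHermite]
    exact ⟨hX.sub_of_left hlt, by
      rw [natDegree_eq_of_degree_eq (degree_sub_eq_left_of_degree_lt hlt), hXd]⟩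

theorem integrable_eval_mul_exp_neg_sq (p : ℝ[X]) :
    Integrable fun x : ℝ => p.eval x * Real.exp (-x ^ 2) := by
  induction p using Polynomial.induction_on' with
  | add p q hp hq => simp only [eval_add, add_mul]; exact hp.add hq
  | monomial n a =>
    have h := (integrable_rpow_mul_exp_neg_mul_sq (b := 1) one_pos (s := n)
      (by have := n.cast_nonneg (α := ℝ); linarith)).const_mul a
    simpa [mul_assoc] using h

theorem integral_monicHermite_succ_mul (n : ℕ) (q : ℝ[X]) :
    ∫ x : ℝ, (monicHermite (n + 1) * q).eval x * Real.exp (-x ^ 2) =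
      (1 / 2) * ∫ x : ℝ, (monicHermite n * derivative q).eval x * Real.exp (-x ^ 2) := by
  set r := monicHermite n * q with hr
  have hderiv (x : ℝ) : HasDerivAt (fun x : ℝ => r.eval x * Real.exp (-x ^ 2))
      ((derivative r - C 2 * X * r).eval x * Real.exp (-x ^ 2)) x := by
    refine ((r.hasDerivAt x).fun_mul (hasDerivAt_pow 2 x).fun_neg.exp).congr_deriv ?_
    simp only [eval_sub, eval_mul, eval_C, eval_X]
    push_cast
    ring
  have hzero := integral_eq_zero_of_hasDerivAt_of_integrable hderiv
    (integrable_eval_mul_exp_neg_sq _) (integrable_eval_mul_exp_neg_sq _)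
  rw [← integral_const_mul, ← sub_eq_zero, ← integral_sub
    (integrable_eval_mul_exp_neg_sq _) ((integrable_eval_mul_exp_neg_sq _).const_mul _)]
  rw [← mul_zero (-1 / 2 : ℝ), ← hzero, ← integral_const_mul]
  congr 1
  ext x
  simp [hr, monicHermite]
  ring

theorem integral_monicHermite_mul (n : ℕ) (q : ℝ[X]) :
    ∫ x : ℝ, (monicHermite n * q).eval x * Real.exp (-x ^ 2) =
      (1 / 2) ^ n * ∫ x : ℝ, (derivative^[n] q).eval x * Real.exp (-x ^ 2) := by
  induction n generalizing q with
  | zero => simp [monicHermite]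
  | succ n ih =>
    rw [integral_monicHermite_succ_mul, ih, Function.iterate_succ_apply]
    ring

theorem integral_monicHermite_mul_of_lt {m n : ℕ} (h : m < n) :
    ∫ x : ℝ, (monicHermite n * monicHermite m).eval x * Real.exp (-x ^ 2) = 0 := by
  rw [integral_monicHermite_mul,
    iterate_derivative_eq_zero (by rwa [(monicHermite_spec m).2])]
  simp

theorem integral_monicHermite_sq (n : ℕ) :
    ∫ x : ℝ, (monicHermite n * monicHermite n).eval x * Real.exp (-x ^ 2) =
      (1 / 2) ^ n * (n.factorial * √Real.pi) := by
  have hconst : derivative^[n] (monicHermite n) = C (n.factorial : ℝ) := by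
    have hdeg : (derivative^[n] (monicHermite n)).natDegree = 0 := by
      have := natDegree_iterate_derivative (monicHermite n) n
      rw [(monicHermite_spec n).2] at this
      omega
    rw [eq_C_of_natDegree_eq_zero hdeg, coeff_iterate_derivative, zero_add,
      Nat.descFactorial_self]
    have := (monicHermite_spec n).1.coeff_natDegree
    rw [(monicHermite_spec n).2] at this
    simp [this]
  have hg := integral_gaussian 1
  simp only [neg_mul, one_mul, div_one] at hg
  rw [integral_monicHermite_mul, hconst]
  simp only [eval_C]
  rw [integral_const_mul, hg]

theorem integral_monicHermite_mul_monicHermite (m n : ℕ) :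
    ∫ x : ℝ, (monicHermite m).eval x * ((monicHermite n).eval x * Real.exp (-x ^ 2)) =
      if m = n then (1 / 2) ^ n * (n.factorial * √Real.pi) else 0 := by
  simp only [← mul_assoc (eval _ _), ← eval_mul]
  split_ifs with h
  · rw [h, integral_monicHermite_sq]
  · rcases lt_or_gt_of_ne h with h | h
    · rw [mul_comm, integral_monicHermite_mul_of_lt h]
    · exact integral_monicHermite_mul_of_lt h

theorem det_monicHermite {N : ℕ} (l : Fin N → ℝ) :
    (Matrix.of fun i j : Fin N => (monicHermite i).eval (l j)).det =
      ∏ i : Fin N, ∏ j ∈ Finset.Ioi i, (l j - l i) := by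
  rw [← Matrix.det_vandermonde, Matrix.det_eval_matrixOfPolynomials_eq_det_vandermonde l
    (fun i => monicHermite i) (fun i => (monicHermite_spec i).2)
    (fun i => (monicHermite_spec i).1), ← Matrix.det_transpose]
  rfl

theorem det_monicHermite_mul_exp {N : ℕ} (l : Fin N → ℝ) :
    (Matrix.of fun i j : Fin N => (monicHermite i).eval (l j) * Real.exp (-l j ^ 2)).det =
      (∏ i : Fin N, ∏ j ∈ Finset.Ioi i, (l j - l i)) * Real.exp (-∑ i, l i ^ 2) := by
  have h := Matrix.det_mul_row (fun j => Real.exp (-l j ^ 2))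
    (Matrix.of fun i j : Fin N => (monicHermite i).eval (l j))
  rw [det_monicHermite, ← Real.exp_sum, Finset.sum_neg_distrib] at h
  rw [mul_comm, ← h]
  congr 1
  ext i j
  exact mul_comm _ _

theorem prod_two_inv_pow (N : ℕ) :
    ∏ k ∈ Finset.range N, (1 / 2 : ℝ) ^ k = (2 : ℝ) ^ (-((N : ℝ) * ((N : ℝ) - 1) / 2)) := by
  induction N with
  | zero => simp
  | succ N ih =>
    rw [Finset.prod_range_succ, ih, one_div, inv_pow, ← Real.rpow_natCast, ← Real.rpow_neg
      zero_le_two, ← Real.rpow_add two_pos]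
    congr 1
    push_cast
    ring

end GaussianMatrixModel

open GaussianMatrixModel

/-- The normalization of the Gaussian matrix model:
`∫_{ℝ^N} Δ(λ)² e^{-∑ λᵢ²} dλ = N! π^{N/2} 2^{-N(N-1)/2} ∏_{k=0}^{N-1} k!`,
where `Δ(λ)²` is the squared Vandermonde product. -/
theorem gaussian_matrix_model_partition_function (N : ℕ) (hN : 1 ≤ N) :
    ∫ l : Fin N → ℝ,
        (∏ i : Fin N, ∏ j ∈ Finset.Ioi i, (l i - l j) ^ 2) * Real.exp (-∑ i, l i ^ 2)
      = (N.factorial : ℝ) * Real.pi ^ ((N : ℝ) / 2) *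
          (2 : ℝ) ^ (-((N : ℝ) * ((N : ℝ) - 1) / 2)) *
          ∏ k ∈ Finset.range N, (k.factorial : ℝ) := by
  have hint (l : Fin N → ℝ) :
      (∏ i : Fin N, ∏ j ∈ Finset.Ioi i, (l i - l j) ^ 2) * Real.exp (-∑ i, l i ^ 2) =
        (Matrix.of fun i j : Fin N => (monicHermite i).eval (l j)).det *
        (Matrix.of fun i j : Fin N =>
          (monicHermite i).eval (l j) * Real.exp (-l j ^ 2)).det := by
    rw [det_monicHermite, det_monicHermite_mul_exp,
      ← mul_assoc, ← sq]
    simp_rw [← Finset.prod_pow, sub_sq_comm (l _) (l _)]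
  have hdiag : (Matrix.of fun i j : Fin N => ∫ x : ℝ, (monicHermite i).eval x *
      ((monicHermite j).eval x * Real.exp (-x ^ 2))) =
      Matrix.diagonal fun i : Fin N =>
        (1 / 2 : ℝ) ^ (i : ℕ) * ((i : ℕ).factorial * √Real.pi) := by
    ext i j
    rw [Matrix.of_apply, integral_monicHermite_mul_monicHermite,
      Matrix.diagonal_apply]
    by_cases h : i = j
    · simp [h]
    · simp [h, Fin.val_inj]
  simp_rw [hint]
  rw [integral_det_mul_det
    (fun (i : Fin N) x => (monicHermite i).eval x)
    (fun (i : Fin N) x => (monicHermite i).eval x * Real.exp (-x ^ 2)),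
    hdiag, Matrix.det_diagonal,
    Fin.prod_univ_eq_prod_range
      (fun k => (1 / 2 : ℝ) ^ k * ((k.factorial : ℝ) * √Real.pi)) N,
    Finset.prod_mul_distrib, Finset.prod_mul_distrib, prod_two_inv_pow,
    Finset.prod_const, Finset.card_range, Real.sqrt_eq_rpow, ← Real.rpow_mul_natCast Real.pi_pos.le,
    one_div_mul_eq_div]
  · ring
  · intro i j
    simp_rw [← mul_assoc, ← Polynomial.eval_mul]
    exact integrable_eval_mul_exp_neg_sq _
end

section
/- Let N ≥ 1, let H_N be the real vector space of Hermitian N×N complex matrices with its Borel σ-algebra and an additive Haar measure μ, and let f : H_N → ℝ be a measurable function invariant under unitary conjugation (f(U A U⁻¹) = f(A) for all unitary U) such that A ↦ f(A) e^{−Tr(A²)} is μ-integrable. Then (∫_{H_N} f(A) e^{−Tr(A²)} dμ(A)) · (∫_{ℝ^N} Δ(λ)² e^{−∑_i λ_i²} dλ) = (∫_{ℝ^N} f(diag(λ)) Δ(λ)² e^{−∑_i λ_i²} dλ) · (∫_{H_N} e^{−Tr(A²)} dμ(A)): conjugation-invariant Gaussian integrals over Hermitian matrices reduce to eigenvalue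 integrals against the squared Vandermonde density. -/
open MeasureTheory

/-- The squared Vandermonde product `Δ(λ)² = ∏_{i<j} (λᵢ - λⱼ)²`. -/
noncomputable def vandermondeSq (N : ℕ) (l : Fin N → ℝ) : ℝ :=
  ∏ i : Fin N, ∏ j ∈ Finset.Ioi i, (l i - l j) ^ 2

/-- The real diagonal matrix `diag (λ₁, …, λ_N)` as a Hermitian (self-adjoint) matrix. -/
noncomputable def hermDiag (N : ℕ) (l : Fin N → ℝ) :
    selfAdjoint (Matrix (Fin N) (Fin N) ℂ) :=
  ⟨Matrix.diagonal fun i => (l i : ℂ), by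
    rw [selfAdjoint.mem_iff]
    ext i j
    by_cases h : i = j
    · subst h; simp [Matrix.star_apply, Matrix.diagonal_apply]
    · simp [Matrix.star_apply, Matrix.diagonal_apply, h, Ne.symm h]⟩

namespace HermitianReduction

open scoped Matrix.Norms.L2Operator

/-- Hermitian matrices, as a real normed space for the `L²` operator norm. -/
abbrev Herm (N : ℕ) : Type := selfAdjoint (Matrix (Fin N) (Fin N) ℂ)

variable {N : ℕ}

instance finiteDimensional_herm : FiniteDimensional ℝ (Herm N) :=
  inferInstanceAs (FiniteDimensional ℝ (selfAdjoint.submodule ℝ (Matrix (Fin N) (Fin N) ℂ)))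

instance completeSpace_herm : CompleteSpace (Herm N) := FiniteDimensional.complete ℝ _

instance properSpace_herm : ProperSpace (Herm N) := FiniteDimensional.proper ℝ _

lemma herm_apply_conj (A : Herm N) (i j : Fin N) :
    (starRingEnd ℂ) ((A : Matrix (Fin N) (Fin N) ℂ) i j) =
      (A : Matrix (Fin N) (Fin N) ℂ) j i := by
  have h : star (A : Matrix (Fin N) (Fin N) ℂ) j i = (A : Matrix (Fin N) (Fin N) ℂ) j i := by
    rw [selfAdjoint.mem_iff.1 A.2]
  simpa [Matrix.star_apply] using h

lemma herm_apply_self (A : Herm N) (i : Fin N) :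
    (((A : Matrix (Fin N) (Fin N) ℂ) i i).re : ℂ) = (A : Matrix (Fin N) (Fin N) ℂ) i i :=
  Complex.conj_eq_iff_re.1 (herm_apply_conj A i i)

lemma coe_hermDiag (l : Fin N → ℝ) :
    (hermDiag N l : Matrix (Fin N) (Fin N) ℂ) = Matrix.diagonal fun i => (l i : ℂ) := rfl

/-- The inclusion of Hermitian matrices into all matrices. -/
noncomputable def inclL : Herm N →L[ℝ] Matrix (Fin N) (Fin N) ℂ :=
  LinearMap.toContinuousLinearMap (selfAdjoint.submodule ℝ (Matrix (Fin N) (Fin N) ℂ)).subtype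

@[simp] lemma inclL_apply (A : Herm N) : inclL A = (A : Matrix (Fin N) (Fin N) ℂ) := rfl

/-- `hermDiag` as a continuous linear map. -/
noncomputable def diagL : (Fin N → ℝ) →L[ℝ] Herm N :=
  LinearMap.toContinuousLinearMap
    { toFun := hermDiag N
      map_add' := fun x y => by
        ext i j
        by_cases h : i = j
        · subst h; simp [coe_hermDiag]
        · simp [coe_hermDiag, h]
      map_smul' := fun c x => by
        ext i j
        by_cases h : i = j
        · subst h; simp [coe_hermDiag]
        · simp [coe_hermDiag, h] }

@[simp] lemma diagL_apply (l : Fin N → ℝ) : diagL l = hermDiag N l := rfl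

/-- The diagonal entries of a Hermitian matrix. -/
noncomputable def diagPart : Herm N →L[ℝ] (Fin N → ℝ) :=
  LinearMap.toContinuousLinearMap
    { toFun := fun A i => ((A : Matrix (Fin N) (Fin N) ℂ) i i).re
      map_add' := fun x y => by ext i; simp
      map_smul' := fun c x => by ext i; simp }

@[simp] lemma diagPart_apply (A : Herm N) (i : Fin N) :
    diagPart A i = ((A : Matrix (Fin N) (Fin N) ℂ) i i).re := rfl

@[simp] lemma diagPart_hermDiag (l : Fin N → ℝ) : diagPart (hermDiag N l) = l := by
  ext i; simp [coe_hermDiag]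

/-- Conjugation of Hermitian matrices by a unitary matrix. -/
noncomputable def conj (u : unitary (Matrix (Fin N) (Fin N) ℂ)) : Herm N →L[ℝ] Herm N :=
  LinearMap.toContinuousLinearMap
    { toFun := fun A => ⟨u * A * star (u : Matrix (Fin N) (Fin N) ℂ), A.2.conjugate _⟩
      map_add' := fun x y => by ext1; simp [mul_add, add_mul]
      map_smul' := fun c x => by ext1; simp }

@[simp] lemma coe_conj (u : unitary (Matrix (Fin N) (Fin N) ℂ)) (A : Herm N) :
    (conj u A : Matrix (Fin N) (Fin N) ℂ) = u * A * star (u : Matrix (Fin N) (Fin N) ℂ) := rfl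

lemma conj_mul (u v : unitary (Matrix (Fin N) (Fin N) ℂ)) (A : Herm N) :
    conj (u * v) A = conj u (conj v A) := by
  ext1; simp [mul_assoc]

@[simp] lemma conj_one (A : Herm N) : conj 1 A = A := by
  ext1; simp

@[simp] lemma conj_inv_conj (u : unitary (Matrix (Fin N) (Fin N) ℂ)) (A : Herm N) :
    conj u⁻¹ (conj u A) = A := by
  rw [← conj_mul]; simp

@[simp] lemma conj_conj_inv (u : unitary (Matrix (Fin N) (Fin N) ℂ)) (A : Herm N) :
    conj u (conj u⁻¹ A) = A := by
  rw [← conj_mul]; simp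

lemma norm_conj (u : unitary (Matrix (Fin N) (Fin N) ℂ)) (A : Herm N) : ‖conj u A‖ = ‖A‖ := by
  change ‖(u : Matrix (Fin N) (Fin N) ℂ) * A *
    ((star u : unitary (Matrix (Fin N) (Fin N) ℂ)) : Matrix (Fin N) (Fin N) ℂ)‖ = _
  rw [CStarRing.norm_mul_coe_unitary, CStarRing.norm_coe_unitary_mul]
  rfl

lemma image_conj (u : unitary (Matrix (Fin N) (Fin N) ℂ)) (S : Set (Herm N)) :
    conj u '' S = conj u⁻¹ ⁻¹' S := by
  ext A
  constructor
  · rintro ⟨B, hB, rfl⟩; simpa using hB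
  · intro h; exact ⟨_, h, by simp⟩

lemma abs_det_conj (u : unitary (Matrix (Fin N) (Fin N) ℂ)) : |(conj u).det| = 1 := by
  borelize (Herm N)
  have hball : conj u '' Metric.ball (0 : Herm N) 1 = Metric.ball 0 1 := by
    rw [image_conj]
    ext A
    rw [Set.mem_preimage, mem_ball_zero_iff, mem_ball_zero_iff, norm_conj]
  have h := Measure.addHaar_image_linearMap (Measure.addHaar : Measure (Herm N))
    (conj u : Herm N →ₗ[ℝ] Herm N) (Metric.ball 0 1)
  rw [ContinuousLinearMap.coe_coe, hball] at h
  have h0 : (Measure.addHaar : Measure (Herm N)) (Metric.ball 0 1) ≠ 0 :=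
    (Metric.measure_ball_pos _ _ one_pos).ne'
  have h1 : (Measure.addHaar : Measure (Herm N)) (Metric.ball 0 1) ≠ ⊤ :=
    measure_ball_lt_top.ne
  have h2 : ENNReal.ofReal |LinearMap.det (conj u : Herm N →ₗ[ℝ] Herm N)| = 1 := by
    rw [eq_comm, ← ENNReal.mul_left_inj h0 h1]
    simpa using h
  simpa using h2

lemma measure_preimage_conj [MeasurableSpace (Herm N)] [BorelSpace (Herm N)]
    (μ : Measure (Herm N)) [μ.IsAddHaarMeasure]
    (u : unitary (Matrix (Fin N) (Fin N) ℂ)) (S : Set (Herm N)) :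
    μ (conj u ⁻¹' S) = μ S := by
  have h := Measure.addHaar_image_linearMap μ (conj u⁻¹ : Herm N →ₗ[ℝ] Herm N) S
  rw [ContinuousLinearMap.coe_coe, image_conj, inv_inv] at h
  rw [h]
  have := abs_det_conj u⁻¹
  rw [ContinuousLinearMap.det] at this
  rw [this]
  simp

/-- Entrywise multiplication by a real symmetric array. -/
noncomputable def schur (k : Fin N → Fin N → ℝ) (hk : ∀ i j, k i j = k j i) :
    Herm N →ₗ[ℝ] Herm N where
  toFun A := ⟨Matrix.of fun i j => (k i j : ℂ) * (A : Matrix (Fin N) (Fin N) ℂ) i j, by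
    rw [selfAdjoint.mem_iff]
    ext i j
    simp [Matrix.star_apply, hk j i, herm_apply_conj]⟩
  map_add' x y := by ext i j; simp [mul_add]
  map_smul' c x := by ext i j; simp; ring

@[simp] lemma schur_apply (k : Fin N → Fin N → ℝ) (hk : ∀ i j, k i j = k j i) (A : Herm N)
    (i j : Fin N) : (schur k hk A : Matrix (Fin N) (Fin N) ℂ) i j =
      (k i j : ℂ) * (A : Matrix (Fin N) (Fin N) ℂ) i j := rfl

/-- Real coordinates on Hermitian matrices: real parts on and above the diagonal, imaginary parts
below it. -/
noncomputable def realCoord (N : ℕ) : Herm N ≃ₗ[ℝ] (Fin N × Fin N → ℝ) where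
  toFun A p := if p.1 ≤ p.2 then ((A : Matrix (Fin N) (Fin N) ℂ) p.1 p.2).re
    else ((A : Matrix (Fin N) (Fin N) ℂ) p.1 p.2).im
  map_add' x y := by ext p; dsimp; split_ifs <;> simp
  map_smul' c x := by ext p; dsimp; split_ifs <;> simp
  invFun R := ⟨Matrix.of fun i j => if i = j then (R (i, i) : ℂ) else
      if i < j then ⟨R (i, j), - R (j, i)⟩ else ⟨R (j, i), R (i, j)⟩, by
    rw [selfAdjoint.mem_iff]
    ext i j
    rcases lt_trichotomy i j with h | h | h
    · simp [Matrix.star_apply, h, h.ne, h.ne', h.not_gt, Complex.ext_iff]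
    · simp [Matrix.star_apply, h]
    · simp [Matrix.star_apply, h, h.ne, h.ne', h.not_gt, Complex.ext_iff]⟩
  left_inv A := by
    ext i j
    rcases lt_trichotomy i j with h | h | h
    · simp [h.ne, h, h.le, h.not_ge, ← herm_apply_conj A i j]
    · simp [h, herm_apply_self]
    · simp [h.ne', h.le, h.not_ge, h.not_gt, ← herm_apply_conj A i j]
  right_inv R := by
    ext ⟨i, j⟩
    rcases lt_trichotomy i j with h | h | h
    · simp [h.ne, h, h.le]
    · simp [h]
    · simp [h.ne', h.not_ge, h.not_gt]

lemma det_schur (k : Fin N → Fin N → ℝ) (hk : ∀ i j, k i j = k j i) :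
    LinearMap.det (schur k hk) = ∏ i, ∏ j, k i j := by
  rw [← LinearMap.det_conj (schur k hk) (realCoord N)]
  have : (realCoord N : Herm N →ₗ[ℝ] _) ∘ₗ schur k hk ∘ₗ ((realCoord N).symm : _ →ₗ[ℝ] Herm N) =
      LinearMap.pi fun p : Fin N × Fin N =>
        (k p.1 p.2 • LinearMap.id : ℝ →ₗ[ℝ] ℝ) ∘ₗ LinearMap.proj p := by
    have key : ∀ A p, realCoord N (schur k hk A) p = k p.1 p.2 * realCoord N A p := by
      intro A p
      simp only [realCoord, LinearEquiv.coe_mk, LinearMap.coe_mk, AddHom.coe_mk, schur_apply]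
      split_ifs <;> simp
    refine LinearMap.ext fun R => funext fun p => ?_
    simp [key]
  rw [this, LinearMap.det_pi, Fintype.prod_prod_type]
  simp

/-- The antisymmetric sign array. -/
noncomputable def sgn (i j : Fin N) : ℝ := if i < j then 1 else if j < i then -1 else 0

lemma sgn_swap (i j : Fin N) : sgn i j = - sgn j i := by
  rcases lt_trichotomy i j with h | h | h <;> simp [sgn, h, h.not_gt]

@[simp] lemma sgn_self (i : Fin N) : sgn i i = 0 := by simp [sgn]

lemma sgn_mul_self {i j : Fin N} (h : i ≠ j) : sgn i j * sgn i j = 1 := by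
  rcases lt_trichotomy i j with hlt | hlt | hlt
  · simp [sgn, hlt]
  · exact absurd hlt h
  · simp [sgn, hlt, hlt.not_gt]

/-- The multiplier `sgn i j * (l j - l i)` off the diagonal, `1` on the diagonal. -/
noncomputable def rootMul (l : Fin N → ℝ) (i j : Fin N) : ℝ :=
  if i = j then 1 else sgn i j * (l j - l i)

lemma rootMul_symm (l : Fin N → ℝ) (i j : Fin N) : rootMul l i j = rootMul l j i := by
  unfold rootMul
  by_cases h : i = j
  · simp [h]
  · rw [if_neg h, if_neg (Ne.symm h), sgn_swap]; ring

lemma det_schur_rootMul (l : Fin N → ℝ) :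
    LinearMap.det (schur (rootMul l) (rootMul_symm l)) = vandermondeSq N l := by
  rw [det_schur, vandermondeSq]
  have h1 : ∀ i : Fin N, ∏ j, rootMul l i j = ∏ j ∈ {i}ᶜ, rootMul l j i := by
    intro i
    rw [← Finset.prod_mul_prod_compl {i}]
    simp only [Finset.prod_singleton]
    rw [show rootMul l i i = 1 by simp [rootMul], one_mul]
    exact Finset.prod_congr rfl fun j _ => rootMul_symm l i j
  rw [Finset.prod_congr rfl fun i _ => h1 i,
    ← Finset.prod_prod_Ioi_mul_eq_prod_prod_off_diag]
  refine Finset.prod_congr rfl fun i _ => Finset.prod_congr rfl fun j hj => ?_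
  have hij : i < j := Finset.mem_Ioi.1 hj
  rw [rootMul_symm l j i, rootMul, if_neg hij.ne, sgn, if_pos hij]
  ring

/-- The skew-Hermitian generator attached to the off-diagonal part of a Hermitian matrix. -/
noncomputable def gen : Herm N →L[ℝ] Matrix (Fin N) (Fin N) ℂ :=
  LinearMap.toContinuousLinearMap
    { toFun := fun A => Matrix.of fun i j => (sgn i j : ℂ) * (A : Matrix (Fin N) (Fin N) ℂ) i j
      map_add' := fun x y => by ext i j; simp [mul_add]
      map_smul' := fun c x => by ext i j; simp; ring }

@[simp] lemma gen_apply (A : Herm N) (i j : Fin N) :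
    gen A i j = (sgn i j : ℂ) * (A : Matrix (Fin N) (Fin N) ℂ) i j := rfl

@[simp] lemma gen_hermDiag (l : Fin N → ℝ) : gen (hermDiag N l) = 0 := by
  ext i j
  by_cases h : i = j
  · simp [h]
  · simp [coe_hermDiag, h]

lemma gen_mem_skewAdjoint (A : Herm N) :
    gen A ∈ skewAdjoint (Matrix (Fin N) (Fin N) ℂ) := by
  rw [skewAdjoint.mem_iff]
  ext i j
  rw [Matrix.star_apply, Matrix.neg_apply, gen_apply, gen_apply, sgn_swap]
  simp [herm_apply_conj]

/-- The unitary matrix generated by the off-diagonal part of a Hermitian matrix. -/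
noncomputable def rot (A : Herm N) : unitary (Matrix (Fin N) (Fin N) ℂ) :=
  ⟨NormedSpace.exp (gen A),
    letI : NormedAlgebra ℚ (Matrix (Fin N) (Fin N) ℂ) := .restrictScalars ℚ ℂ _
    NormedSpace.exp_mem_unitary_of_mem_skewAdjoint (gen_mem_skewAdjoint A)⟩

lemma coe_rot (A : Herm N) : (rot A : Matrix (Fin N) (Fin N) ℂ) = NormedSpace.exp (gen A) := rfl

/-- The local parametrization `A ↦ exp(X) D exp(-X)` of Hermitian matrices, where `D` is the
diagonal part of `A` and `X` is the generator attached to its off-diagonal part. -/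
noncomputable def param (A : Herm N) : Herm N := conj (rot A) (hermDiag N (diagPart A))

lemma contDiff_exp_matrix :
    ContDiff ℝ 1 (NormedSpace.exp : Matrix (Fin N) (Fin N) ℂ → Matrix (Fin N) (Fin N) ℂ) :=
  contDiff_iff_contDiffAt.2 fun x => (NormedSpace.exp_analytic (𝕂 := ℝ) x).contDiffAt

/-- The self-adjoint part of a matrix, as a continuous linear map. -/
noncomputable def projL : Matrix (Fin N) (Fin N) ℂ →L[ℝ] Herm N :=
  LinearMap.toContinuousLinearMap (selfAdjointPart ℝ)

lemma projL_coe (A : Herm N) : projL (A : Matrix (Fin N) (Fin N) ℂ) = A :=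
  IsSelfAdjoint.selfAdjointPart_apply ℝ A.2

lemma coe_projL {X : Matrix (Fin N) (Fin N) ℂ} (hX : star X = X) :
    (projL X : Matrix (Fin N) (Fin N) ℂ) = X :=
  IsSelfAdjoint.coe_selfAdjointPart_apply ℝ hX

/-- The adjoint, as a continuous real-linear map. -/
noncomputable def adjL : Matrix (Fin N) (Fin N) ℂ →L[ℝ] Matrix (Fin N) (Fin N) ℂ :=
  LinearMap.toContinuousLinearMap
    { toFun := star
      map_add' := star_add
      map_smul' := fun c x => by simp }

@[simp] lemma adjL_apply (X : Matrix (Fin N) (Fin N) ℂ) : adjL X = star X := rfl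

lemma contDiff_param : ContDiff ℝ 1 (param : Herm N → Herm N) := by
  have h : (param : Herm N → Herm N) = fun A => projL
      (NormedSpace.exp (gen A) * inclL (diagL (diagPart A)) * adjL (NormedSpace.exp (gen A))) := by
    ext1 A
    exact (projL_coe (param A)).symm
  rw [h]
  have hU : ContDiff ℝ 1 fun A : Herm N => NormedSpace.exp (gen A) :=
    contDiff_exp_matrix.comp gen.contDiff
  have hD : ContDiff ℝ 1 fun A : Herm N => inclL (diagL (diagPart A)) :=
    (inclL ∘L diagL ∘L diagPart).contDiff
  exact projL.contDiff.comp ((hU.mul hD).mul (adjL.contDiff.comp hU))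

/-- The logarithmic derivative `exp(-X) d(exp X)` of the exponential at `X`, in the
direction `gen M`. -/
noncomputable def logDeriv (X : Matrix (Fin N) (Fin N) ℂ) :
    Herm N →L[ℝ] Matrix (Fin N) (Fin N) ℂ :=
  (ContinuousLinearMap.mul ℝ _ (star (NormedSpace.exp X))) ∘L
    (fderiv ℝ NormedSpace.exp X) ∘L gen

lemma logDeriv_apply (X : Matrix (Fin N) (Fin N) ℂ) (M : Herm N) :
    logDeriv X M = star (NormedSpace.exp X) * fderiv ℝ NormedSpace.exp X (gen M) := rfl

lemma hasFDerivAt_exp_gen (A : Herm N) :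
    HasFDerivAt (fun A : Herm N => NormedSpace.exp (gen A))
      ((fderiv ℝ NormedSpace.exp (gen A)) ∘L gen) A :=
  ((contDiff_exp_matrix.differentiable one_ne_zero _).hasFDerivAt).comp A gen.hasFDerivAt

lemma star_logDeriv (A M : Herm N) : star (logDeriv (gen A) M) = - logDeriv (gen A) M := by
  have h1 := hasFDerivAt_exp_gen A
  have h2 := (adjL.hasFDerivAt (x := NormedSpace.exp (gen A))).comp A h1
  have h3 := h2.mul' h1
  have h4 : HasFDerivAt (fun A : Herm N => (1 : Matrix (Fin N) (Fin N) ℂ)) _ A :=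
    h3.congr_of_eventuallyEq (Filter.Eventually.of_forall fun B =>
      ((Unitary.mem_iff.1 (rot B).2).1).symm)
  have h5 := congrArg (fun T => T M) (h4.unique (hasFDerivAt_const _ _))
  simp only [Function.comp_apply, adjL_apply, add_apply,
    smul_apply, ContinuousLinearMap.comp_apply, smul_eq_mul,
    MulOpposite.smul_eq_mul_unop, MulOpposite.unop_op, zero_apply] at h5
  rw [logDeriv_apply, star_mul, star_star]
  exact eq_neg_of_add_eq_zero_right h5

lemma coe_fderiv_param (A M : Herm N) :
    (fderiv ℝ param A M : Matrix (Fin N) (Fin N) ℂ) =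
      rot A * (logDeriv (gen A) M * hermDiag N (diagPart A) + hermDiag N (diagPart M)
        - hermDiag N (diagPart A) * logDeriv (gen A) M) *
        star (rot A : Matrix (Fin N) (Fin N) ℂ) := by
  have h0 := inclL.hasFDerivAt.comp A
    ((contDiff_param (N := N)).differentiable one_ne_zero A).hasFDerivAt
  have h1 := hasFDerivAt_exp_gen A
  have h2 := (adjL.hasFDerivAt (x := NormedSpace.exp (gen A))).comp A h1
  have h3 := (h1.mul' (inclL ∘L diagL ∘L diagPart).hasFDerivAt).mul' h2
  have h4 := congrArg (fun T => T M) (h0.unique h3)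
  have h5 : fderiv ℝ NormedSpace.exp (gen A) (gen M) =
      NormedSpace.exp (gen A) * logDeriv (gen A) M := by
    rw [logDeriv_apply, ← mul_assoc, ← coe_rot, (Unitary.mem_iff.1 (rot A).2).2, one_mul]
  simp only [Function.comp_apply, adjL_apply, add_apply,
    smul_apply, ContinuousLinearMap.comp_apply, smul_eq_mul,
    MulOpposite.smul_eq_mul_unop, MulOpposite.unop_op, inclL_apply, diagL_apply, h5, star_mul,
    star_logDeriv, Pi.mul_apply] at h4
  rw [h4, coe_rot]
  noncomm_ring

/-- The angular factor of the derivative of `param`. -/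
noncomputable def angular (X : Matrix (Fin N) (Fin N) ℂ) : Herm N →L[ℝ] Herm N :=
  diagL ∘L diagPart + projL ∘L LinearMap.toContinuousLinearMap
    { toFun := fun M => Matrix.of fun i j => (sgn i j : ℂ) * logDeriv X M i j
      map_add' := fun x y => by ext i j; simp [mul_add]
      map_smul' := fun c x => by ext i j; simp; ring }

lemma coe_angular_apply (A M : Herm N) (i j : Fin N) :
    (angular (gen A) M : Matrix (Fin N) (Fin N) ℂ) i j =
      (hermDiag N (diagPart M) : Matrix (Fin N) (Fin N) ℂ) i j
        + (sgn i j : ℂ) * logDeriv (gen A) M i j := by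
  have h : star (Matrix.of fun i j => (sgn i j : ℂ) * logDeriv (gen A) M i j) =
      Matrix.of fun i j => (sgn i j : ℂ) * logDeriv (gen A) M i j := by
    ext i j
    have := congrFun (congrFun (star_logDeriv A M) i) j
    rw [Matrix.star_apply, Matrix.neg_apply] at this
    rw [Matrix.star_apply, Matrix.of_apply, Matrix.of_apply, star_mul', this, sgn_swap]
    simp
  simp [angular, coe_projL h]

lemma fderiv_param (A : Herm N) :
    (fderiv ℝ param A : Herm N →ₗ[ℝ] Herm N) = (conj (rot A) : Herm N →ₗ[ℝ] Herm N) ∘ₗ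
      schur (rootMul (diagPart A)) (rootMul_symm _) ∘ₗ (angular (gen A) : Herm N →ₗ[ℝ] Herm N) := by
  refine LinearMap.ext fun M => Subtype.ext ?_
  simp only [ContinuousLinearMap.coe_coe, LinearMap.comp_apply, coe_conj, coe_fderiv_param]
  congr 2
  ext i j
  rw [schur_apply, coe_angular_apply]
  simp only [coe_hermDiag, Matrix.add_apply, Matrix.sub_apply, Matrix.mul_diagonal,
    Matrix.diagonal_mul]
  by_cases h : i = j
  · subst h; simp [rootMul]; ring
  · have h1 : ((sgn i j : ℝ) : ℂ) * sgn i j = 1 := by exact_mod_cast sgn_mul_self h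
    simp only [rootMul, h, Matrix.diagonal_apply, if_false, Complex.ofReal_mul, Complex.ofReal_sub]
    linear_combination (-((diagPart A j : ℂ) - diagPart A i) * logDeriv (gen A) M i j) * h1

lemma abs_det_fderiv_param (A : Herm N) :
    |(fderiv ℝ param A).det| = vandermondeSq N (diagPart A) * |(angular (gen A)).det| := by
  have h0 : 0 ≤ vandermondeSq N (diagPart A) :=
    Finset.prod_nonneg fun i _ => Finset.prod_nonneg fun j _ => sq_nonneg _
  have h1 : |LinearMap.det (conj (rot A) : Herm N →ₗ[ℝ] Herm N)| = 1 := abs_det_conj (rot A)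
  rw [ContinuousLinearMap.det, fderiv_param, LinearMap.det_comp, LinearMap.det_comp,
    det_schur_rootMul, abs_mul, abs_mul, h1, one_mul, abs_of_nonneg h0]

lemma angular_zero :
    angular (0 : Matrix (Fin N) (Fin N) ℂ) = ContinuousLinearMap.id ℝ (Herm N) := by
  refine ContinuousLinearMap.ext fun M => Subtype.ext ?_
  ext i j
  have h0 : (0 : Matrix (Fin N) (Fin N) ℂ) = gen (0 : Herm N) := by simp
  rw [h0, coe_angular_apply, ← h0, logDeriv_apply, NormedSpace.exp_zero,
    (hasFDerivAt_exp_zero (𝕂 := ℝ) (𝔸 := Matrix (Fin N) (Fin N) ℂ)).fderiv]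
  by_cases h : i = j
  · subst h
    simp [coe_hermDiag, herm_apply_self]
  · have h1 : ((sgn i j : ℝ) : ℂ) * sgn i j = 1 := by exact_mod_cast sgn_mul_self h
    simp [coe_hermDiag, h, ← mul_assoc, h1]

/-- The open Weyl chamber of strictly increasing eigenvalue vectors. -/
def chamber (N : ℕ) : Set (Fin N → ℝ) := {l | StrictMono l}

lemma isOpen_chamber : IsOpen (chamber N) := by
  have : chamber N = ⋂ i : Fin N, ⋂ j : Fin N, ⋂ _ : i < j, {l | l i < l j} := by
    ext l; simp [chamber, StrictMono]
  rw [this]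
  exact isOpen_iInter_of_finite fun i => isOpen_iInter_of_finite fun j =>
    isOpen_iInter_of_finite fun _ => isOpen_lt (continuous_apply i) (continuous_apply j)

lemma vandermondeSq_ne_zero {l : Fin N → ℝ} (hl : Function.Injective l) :
    vandermondeSq N l ≠ 0 :=
  Finset.prod_ne_zero_iff.2 fun _ _ => Finset.prod_ne_zero_iff.2 fun _ hj =>
    pow_ne_zero _ (sub_ne_zero.2 (hl.ne (Finset.mem_Ioi.1 hj).ne))

lemma conj_hermDiag_eq_conj_hermDiag {u v : unitary (Matrix (Fin N) (Fin N) ℂ)}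
    {l m : Fin N → ℝ} (hl : l ∈ chamber N) (hm : m ∈ chamber N)
    (h : conj u (hermDiag N l) = conj v (hermDiag N m)) :
    l = m ∧ ∀ n, conj u (hermDiag N n) = conj v (hermDiag N n) := by
  have hlm : l = m := by
    refine Set.range_injOn_strictMono hl hm ?_
    have h1 := congrArg (fun A : Herm N => spectrum ℂ (A : Matrix (Fin N) (Fin N) ℂ)) h
    simp only [coe_conj, Unitary.spectrum_star_right_conjugate, coe_hermDiag,
      spectrum_diagonal] at h1
    have h2 : ∀ k : Fin N → ℝ, (Set.range fun i => (k i : ℂ)) = Complex.ofReal '' Set.range k :=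
      fun k => Set.range_comp Complex.ofReal k
    rw [h2, h2] at h1
    exact Complex.ofReal_injective.image_injective h1
  subst hlm
  refine ⟨rfl, fun n => ?_⟩
  set w := v⁻¹ * u with hw
  have h1 : conj w (hermDiag N l) = hermDiag N l := by
    rw [hw, conj_mul, h, conj_inv_conj]
  suffices h2 : conj w (hermDiag N n) = hermDiag N n by
    rw [← h2, ← conj_mul v, hw, h2, mul_inv_cancel_left]
  have h3 : ∀ k, conj w (hermDiag N k) = hermDiag N k ↔
      (w : Matrix (Fin N) (Fin N) ℂ) * hermDiag N k = hermDiag N k * w := by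
    intro k
    rw [Subtype.ext_iff, coe_conj]
    constructor
    · intro h
      conv_rhs => rw [← h]
      rw [mul_assoc, (Unitary.mem_iff.1 w.2).1, mul_one]
    · intro h
      rw [h, mul_assoc, (Unitary.mem_iff.1 w.2).2, mul_one]
  rw [h3] at h1 ⊢
  ext i j
  have h4 := congrFun (congrFun h1 i) j
  simp only [coe_hermDiag, Matrix.mul_diagonal, Matrix.diagonal_mul] at h4 ⊢
  by_cases hij : i = j
  · subst hij; ring
  · have h5 : (w : Matrix (Fin N) (Fin N) ℂ) i j * ((l j : ℂ) - l i) = 0 := by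
      linear_combination h4
    have h6 : (l j : ℂ) - l i ≠ 0 :=
      sub_ne_zero.2 fun h => hij (hl.injective (Complex.ofReal_injective h)).symm
    rw [(mul_eq_zero.1 h5).resolve_right h6]
    ring

/-- Hermitian matrices with vanishing diagonal. -/
noncomputable abbrev OffDiag (N : ℕ) : Submodule ℝ (Herm N) :=
  (diagPart (N := N)).toLinearMap.ker

/-- The splitting of Hermitian matrices into diagonal and off-diagonal parts. -/
noncomputable def split (N : ℕ) : ((Fin N → ℝ) × OffDiag N) ≃L[ℝ] Herm N :=
  LinearEquiv.toContinuousLinearEquiv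
    { toFun := fun p => hermDiag N p.1 + p.2
      map_add' := fun x y => by
        have := (diagL (N := N)).map_add x.1 y.1
        simp only [diagL_apply] at this
        simp only [Prod.fst_add, Prod.snd_add, Submodule.coe_add, this]
        abel
      map_smul' := fun c x => by
        have := (diagL (N := N)).map_smul c x.1
        simp only [diagL_apply] at this
        simp [this]
      invFun := fun A => (diagPart A, ⟨A - hermDiag N (diagPart A), by simp⟩)
      left_inv := fun p => by
        have h : diagPart (p.2 : Herm N) = 0 := p.2.2
        ext1
        · simp [h]
        · ext1; simp [h]
      right_inv := fun A => by simp }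

lemma split_apply (p : (Fin N → ℝ) × OffDiag N) : split N p = hermDiag N p.1 + p.2 := rfl

@[simp] lemma diagPart_split (p : (Fin N → ℝ) × OffDiag N) : diagPart (split N p) = p.1 := by
  have h : diagPart (p.2 : Herm N) = 0 := p.2.2
  simp [split_apply, h]

@[simp] lemma gen_split (p : (Fin N → ℝ) × OffDiag N) : gen (split N p) = gen (p.2 : Herm N) := by
  simp [split_apply]

lemma rot_split (l m : Fin N → ℝ) (y : OffDiag N) :
    rot (split N (l, y)) = rot (split N (m, y)) := by
  ext1; simp [coe_rot]

lemma param_split (l m : Fin N → ℝ) (y : OffDiag N) :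
    param (split N (l, y)) = conj (rot (split N (m, y))) (hermDiag N l) := by
  rw [param, rot_split l m, diagPart_split]

/-- A fixed point of the Weyl chamber. -/
noncomputable def basePoint (N : ℕ) : Fin N → ℝ := fun i => (i : ℕ)

lemma basePoint_mem : basePoint N ∈ chamber N := fun i j h => by
  simpa [basePoint] using h

/-- The image under `split` of the product of the chamber with `W`. -/
noncomputable def cell (W : Set (OffDiag N)) : Set (Herm N) := (split N).symm ⁻¹' (chamber N ×ˢ W)

lemma split_mem_cell {W : Set (OffDiag N)} {p : (Fin N → ℝ) × OffDiag N} :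
    split N p ∈ cell W ↔ p.1 ∈ chamber N ∧ p.2 ∈ W := by
  simp [cell]

lemma hasStrictFDerivAt_param (N : ℕ) : ∃ e : Herm N ≃L[ℝ] Herm N,
    HasStrictFDerivAt param (e : Herm N →L[ℝ] Herm N) (hermDiag N (basePoint N)) := by
  have h := (contDiff_param (N := N)).contDiffAt.hasStrictFDerivAt
    (x := hermDiag N (basePoint N)) one_ne_zero
  have hdet : (fderiv ℝ param (hermDiag N (basePoint N))).det ≠ 0 := by
    rw [← abs_ne_zero, abs_det_fderiv_param, gen_hermDiag, angular_zero, diagPart_hermDiag]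
    simpa [ContinuousLinearMap.det] using vandermondeSq_ne_zero (basePoint_mem (N := N)).injective
  exact ⟨ContinuousLinearMap.toContinuousLinearEquivOfDetNeZero _ hdet, by simpa using h⟩

lemma param_hermDiag (l : Fin N → ℝ) : param (hermDiag N l) = hermDiag N l := by
  have h : rot (hermDiag N l) = 1 := by ext1; simp [coe_rot]
  rw [param, h, conj_one, diagPart_hermDiag]

lemma split_zero (l : Fin N → ℝ) : split N (l, 0) = hermDiag N l := by simp [split_apply]

lemma exists_window (N : ℕ) : ∃ W : Set (OffDiag N), IsOpen W ∧ 0 ∈ W ∧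
    Set.InjOn (fun y => param (split N (basePoint N, y))) W := by
  obtain ⟨e, he⟩ := hasStrictFDerivAt_param N
  have hc : Continuous fun y : OffDiag N => split N (basePoint N, y) :=
    (split N).continuous.comp (by fun_prop)
  refine ⟨(fun y => split N (basePoint N, y)) ⁻¹' (he.toOpenPartialHomeomorph param).source,
    (he.toOpenPartialHomeomorph param).open_source.preimage hc, ?_, ?_⟩
  · rw [Set.mem_preimage, split_zero]
    exact he.mem_toOpenPartialHomeomorph_source
  · intro y hy z hz h
    have := (he.toOpenPartialHomeomorph param).injOn hy hz (by simpa using h)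
    simpa using this

lemma injOn_param_cell {W : Set (OffDiag N)}
    (hW : Set.InjOn (fun y => param (split N (basePoint N, y))) W) :
    Set.InjOn param (cell W) := by
  intro A hA B hB h
  obtain ⟨⟨l, y⟩, rfl⟩ := (split N).surjective A
  obtain ⟨⟨m, z⟩, rfl⟩ := (split N).surjective B
  rw [split_mem_cell] at hA hB
  rw [param_split l (basePoint N), param_split m (basePoint N)] at h
  obtain ⟨rfl, h2⟩ := conj_hermDiag_eq_conj_hermDiag hA.1 hB.1 h
  have h3 : y = z := hW hA.2 hB.2 (by
    simpa only [param_split (basePoint N) (basePoint N)] using h2 (basePoint N))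
  rw [h3]

lemma conj_hermDiag_mem_image_cell {W : Set (OffDiag N)}
    {u : unitary (Matrix (Fin N) (Fin N) ℂ)} {l m : Fin N → ℝ} (hl : l ∈ chamber N)
    (hm : m ∈ chamber N) (h : conj u (hermDiag N l) ∈ param '' cell W) :
    conj u (hermDiag N m) ∈ param '' cell W := by
  obtain ⟨A, hA, h⟩ := h
  obtain ⟨⟨k, y⟩, rfl⟩ := (split N).surjective A
  rw [split_mem_cell] at hA
  rw [param_split k m] at h
  obtain ⟨-, h2⟩ := conj_hermDiag_eq_conj_hermDiag hA.1 hl h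
  refine ⟨split N (m, y), split_mem_cell.2 ⟨hm, hA.2⟩, ?_⟩
  rw [param_split m m, h2]

lemma image_cell_mem_nhds {W : Set (OffDiag N)} (hW : IsOpen W) (h0 : 0 ∈ W) :
    param '' cell W ∈ nhds (hermDiag N (basePoint N)) := by
  obtain ⟨e, he⟩ := hasStrictFDerivAt_param N
  have h := he.map_nhds_eq_of_equiv
  rw [param_hermDiag] at h
  rw [← h]
  refine Filter.image_mem_map (IsOpen.mem_nhds ?_ ?_)
  · exact (isOpen_chamber.prod hW).preimage (split N).symm.continuous
  · rw [← split_zero, split_mem_cell]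
    exact ⟨basePoint_mem, h0⟩

lemma exists_conj_hermDiag_comp (l : Fin N → ℝ) (σ : Equiv.Perm (Fin N)) :
    ∃ u, hermDiag N (l ∘ σ) = conj u (hermDiag N l) := by
  set P : Matrix (Fin N) (Fin N) ℂ := Matrix.of fun i j => if σ i = j then 1 else 0 with hP
  have hu : P ∈ unitary (Matrix (Fin N) (Fin N) ℂ) := by
    refine Matrix.mem_unitaryGroup_iff.2 ?_
    ext i j
    simp [hP, Matrix.mul_apply, Matrix.star_apply, Matrix.one_apply, eq_comm]
  refine ⟨⟨P, hu⟩, ?_⟩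
  ext i j
  rw [coe_conj]
  by_cases h : i = j
  · subst h
    simp [hP, coe_hermDiag, Matrix.mul_apply, Matrix.star_apply, Matrix.diagonal_apply]
  · simp [hP, coe_hermDiag, Matrix.mul_apply, Matrix.star_apply, Matrix.diagonal_apply, h]

/-- The Hankel determinant `det (Tr A^(i+j))`, the discriminant of the characteristic
polynomial of `A`. -/
noncomputable def hankelDet {R : Type*} [CommRing R] (A : Matrix (Fin N) (Fin N) R) : R :=
  (Matrix.of fun i j : Fin N => (A ^ (i + j : ℕ)).trace).det

lemma hankelDet_conj_hermDiag (u : unitary (Matrix (Fin N) (Fin N) ℂ)) (l : Fin N → ℝ) :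
    hankelDet (conj u (hermDiag N l) : Matrix (Fin N) (Fin N) ℂ) =
      (Matrix.vandermonde fun i => (l i : ℂ)).det ^ 2 := by
  have h : ∀ k : ℕ, ((conj u (hermDiag N l) : Matrix (Fin N) (Fin N) ℂ) ^ k).trace =
      ∑ a, (l a : ℂ) ^ k := by
    intro k
    have h1 : (conj u (hermDiag N l) : Matrix (Fin N) (Fin N) ℂ) ^ k =
        u * (hermDiag N l : Matrix (Fin N) (Fin N) ℂ) ^ k *
          star (u : Matrix (Fin N) (Fin N) ℂ) := by
      induction k with
      | zero => simp
      | succ k ih =>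
        rw [pow_succ, ih, coe_conj, pow_succ]
        simp only [mul_assoc]
        rw [← mul_assoc (star (u : Matrix (Fin N) (Fin N) ℂ)) u, (Unitary.mem_iff.1 u.2).1,
          one_mul]
    rw [h1, Matrix.trace_mul_comm, ← mul_assoc, (Unitary.mem_iff.1 u.2).1, one_mul, coe_hermDiag,
      Matrix.diagonal_pow, Matrix.trace_diagonal]
    rfl
  have h2 : (Matrix.of fun i j : Fin N =>
      ((conj u (hermDiag N l) : Matrix (Fin N) (Fin N) ℂ) ^ (i + j : ℕ)).trace) =
      (Matrix.vandermonde fun i => (l i : ℂ)).transpose *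
        Matrix.vandermonde fun i => (l i : ℂ) := by
    ext i j
    rw [Matrix.of_apply, h]
    simp [Matrix.mul_apply, Matrix.vandermonde_apply, pow_add]
  rw [hankelDet, h2, Matrix.det_mul, Matrix.det_transpose, sq]

lemma exists_conj_hermDiag (A : Herm N) : ∃ u l, A = conj u (hermDiag N l) := by
  have hA : (A : Matrix (Fin N) (Fin N) ℂ).IsHermitian := A.2
  refine ⟨hA.eigenvectorUnitary, hA.eigenvalues, Subtype.ext ?_⟩
  exact hA.spectral_theorem

lemma exists_mem_chamber {A : Herm N} (hA : hankelDet (A : Matrix (Fin N) (Fin N) ℂ) ≠ 0) :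
    ∃ u, ∃ l ∈ chamber N, A = conj u (hermDiag N l) := by
  obtain ⟨u, l, rfl⟩ := exists_conj_hermDiag A
  rw [hankelDet_conj_hermDiag, pow_ne_zero_iff two_ne_zero,
    Matrix.det_vandermonde_ne_zero_iff] at hA
  have hl : Function.Injective l := fun i j h => hA (by simp [h])
  obtain ⟨v, hv⟩ := exists_conj_hermDiag_comp l (Tuple.sort l)
  refine ⟨u * v⁻¹, l ∘ Tuple.sort l,
    (Tuple.monotone_sort l).strictMono_of_injective (hl.comp (Equiv.injective _)), ?_⟩
  rw [hv, conj_mul, conj_inv_conj]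

lemma hankelDet_map {R S : Type*} [CommRing R] [CommRing S] (f : R →+* S)
    (A : Matrix (Fin N) (Fin N) R) : hankelDet (A.map f) = f (hankelDet A) := by
  rw [hankelDet, hankelDet, RingHom.map_det]
  congr 1
  ext i j
  simp only [Matrix.of_apply, RingHom.mapMatrix_apply, Matrix.map_apply]
  rw [← RingHom.mapMatrix_apply, ← map_pow, RingHom.mapMatrix_apply, AddMonoidHom.map_trace]

lemma hankelDet_smul_ne_zero {K : Type*} [Field K] {c : K} (hc : c ≠ 0)
    {A : Matrix (Fin N) (Fin N) K} (hA : hankelDet A ≠ 0) : hankelDet (c • A) ≠ 0 := by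
  have h : (Matrix.of fun i j : Fin N => ((c • A) ^ (i + j : ℕ)).trace) =
      Matrix.of fun i j : Fin N => c ^ (i : ℕ) * (Matrix.of fun i j : Fin N => c ^ (j : ℕ) *
        (Matrix.of fun i j : Fin N => (A ^ (i + j : ℕ)).trace) i j) i j := by
    ext i j
    simp [smul_pow, pow_add]
    ring
  rw [hankelDet, h, Matrix.det_mul_column, Matrix.det_mul_row]
  refine mul_ne_zero (Finset.prod_ne_zero_iff.2 fun i _ => pow_ne_zero _ hc)
    (mul_ne_zero (Finset.prod_ne_zero_iff.2 fun i _ => pow_ne_zero _ hc) hA)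

lemma continuous_hankelDet :
    Continuous fun A : Herm N => hankelDet (A : Matrix (Fin N) (Fin N) ℂ) := by
  unfold hankelDet
  refine Continuous.matrix_det (continuous_matrix fun i j => ?_)
  exact (continuous_subtype_val.pow _).matrix_trace

lemma hankelDet_basePoint_ne_zero :
    hankelDet (hermDiag N (basePoint N) : Matrix (Fin N) (Fin N) ℂ) ≠ 0 := by
  have h := hankelDet_conj_hermDiag 1 (basePoint N)
  rw [conj_one] at h
  rw [h, pow_ne_zero_iff two_ne_zero, Matrix.det_vandermonde_ne_zero_iff]
  exact Complex.ofReal_injective.comp (basePoint_mem (N := N)).injective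

lemma finite_hankelDet_eq_zero (A : Herm N) :
    {s : ℝ | hankelDet (((s : ℂ) • (A : Matrix (Fin N) (Fin N) ℂ)) +
      (hermDiag N (basePoint N) : Matrix (Fin N) (Fin N) ℂ)) = 0}.Finite := by
  set P : Polynomial ℂ := hankelDet (Matrix.of fun i j =>
    Polynomial.X * Polynomial.C ((A : Matrix (Fin N) (Fin N) ℂ) i j) +
      Polynomial.C ((hermDiag N (basePoint N) : Matrix (Fin N) (Fin N) ℂ) i j)) with hP
  have heval : ∀ s : ℂ, P.eval s =
      hankelDet ((s • (A : Matrix (Fin N) (Fin N) ℂ)) +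
        (hermDiag N (basePoint N) : Matrix (Fin N) (Fin N) ℂ)) := by
    intro s
    rw [hP, ← Polynomial.coe_evalRingHom, ← hankelDet_map]
    congr 1
    ext i j
    simp only [Matrix.map_apply, Matrix.of_apply, Polynomial.coe_evalRingHom, Polynomial.eval_add,
      Polynomial.eval_mul, Polynomial.eval_X, Polynomial.eval_C, Matrix.add_apply, Matrix.smul_apply,
      smul_eq_mul]
  have hP0 : P ≠ 0 := by
    intro h
    have h1 := heval 0
    rw [h, Polynomial.eval_zero, zero_smul, zero_add] at h1
    exact hankelDet_basePoint_ne_zero h1.symm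
  refine Set.Finite.subset ((Polynomial.finite_setOfPred_isRoot hP0).preimage
    Complex.ofReal_injective.injOn) fun s hs => ?_
  simpa [Polynomial.IsRoot, heval] using hs

lemma ae_hankelDet_ne_zero [MeasurableSpace (Herm N)] [BorelSpace (Herm N)]
    (μ : Measure (Herm N)) [μ.IsAddHaarMeasure] :
    ∀ᵐ A : Herm N ∂μ, hankelDet (A : Matrix (Fin N) (Fin N) ℂ) ≠ 0 := by
  set s : Set (Herm N) := {A | hankelDet (A : Matrix (Fin N) (Fin N) ℂ) ≠ 0} with hs
  have hms : MeasurableSet s :=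
    (isOpen_ne_fun continuous_hankelDet continuous_const).measurableSet
  refine ae_mem_of_ae_add_linearMap_mem (LinearMap.toSpanSingleton ℝ (Herm N)
    (hermDiag N (basePoint N))) (volume : Measure ℝ) μ hms fun A => ?_
  rw [ae_iff]
  refine Set.Finite.measure_zero (Set.Finite.subset
    (((finite_hankelDet_eq_zero A).preimage inv_injective.injOn).insert 0) fun t ht => ?_) _
  by_cases h0 : t = 0
  · exact Or.inl h0
  refine Or.inr ?_
  by_contra h
  refine ht ?_
  have h1 := hankelDet_smul_ne_zero (c := (t : ℂ)) (by exact_mod_cast h0) h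
  have h2 : (t : ℂ) • (((t⁻¹ : ℝ) : ℂ) • (A : Matrix (Fin N) (Fin N) ℂ) +
      (hermDiag N (basePoint N) : Matrix (Fin N) (Fin N) ℂ)) =
      ((A + LinearMap.toSpanSingleton ℝ (Herm N) (hermDiag N (basePoint N)) t : Herm N) :
        Matrix (Fin N) (Fin N) ℂ) := by
    ext i j
    simp [mul_add, h0]
  rwa [h2] at h1
instance compactSpace_unitary : CompactSpace (unitary (Matrix (Fin N) (Fin N) ℂ)) := by
  have hb : Bornology.IsBounded
      (unitary (Matrix (Fin N) (Fin N) ℂ) : Set (Matrix (Fin N) (Fin N) ℂ)) := by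
    refine isBounded_iff_forall_norm_le.2 ⟨1 + ‖(1 : Matrix (Fin N) (Fin N) ℂ)‖, fun U hU => ?_⟩
    have h := CStarRing.norm_star_mul_self (x := U)
    rw [(Unitary.mem_iff.1 hU).1] at h
    nlinarith [norm_nonneg U, sq_nonneg (‖U‖ - 1)]
  exact isCompact_iff_compactSpace.1 (Metric.isCompact_of_isClosed_isBounded isClosed_unitary hb)

lemma continuous_conj_inv :
    Continuous fun p : unitary (Matrix (Fin N) (Fin N) ℂ) × Herm N => conj p.1⁻¹ p.2 := by
  refine continuous_induced_rng.2 ?_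
  have h : (Subtype.val ∘ fun p : unitary (Matrix (Fin N) (Fin N) ℂ) × Herm N => conj p.1⁻¹ p.2) =
      fun p => star (p.1 : Matrix (Fin N) (Fin N) ℂ) * (p.2 : Matrix (Fin N) (Fin N) ℂ) *
        (p.1 : Matrix (Fin N) (Fin N) ℂ) := by
    ext1 p
    simp [coe_conj]
  rw [h]
  exact ((continuous_subtype_val.comp continuous_fst).star.mul
    (continuous_subtype_val.comp continuous_snd)).mul (continuous_subtype_val.comp continuous_fst)

lemma haar_mul_measure_inter [MeasurableSpace (Herm N)] [BorelSpace (Herm N)]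
    [MeasurableSpace (unitary (Matrix (Fin N) (Fin N) ℂ))]
    [BorelSpace (unitary (Matrix (Fin N) (Fin N) ℂ))]
    (ν : Measure (unitary (Matrix (Fin N) (Fin N) ℂ))) [ν.IsHaarMeasure]
    (μ : Measure (Herm N)) [μ.IsAddHaarMeasure] {S T : Set (Herm N)} (hS : MeasurableSet S)
    (hSinv : ∀ u A, conj u A ∈ S ↔ A ∈ S) (hT : MeasurableSet T)
    (hTinv : ∀ u, ∀ l ∈ chamber N, ∀ m ∈ chamber N,
      conj u (hermDiag N l) ∈ T → conj u (hermDiag N m) ∈ T) :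
    ν Set.univ * μ (S ∩ T) = ν {g | conj g⁻¹ (hermDiag N (basePoint N)) ∈ T} * μ S := by
  have hE : MeasurableSet {p : unitary (Matrix (Fin N) (Fin N) ℂ) × Herm N |
      p.2 ∈ S ∧ conj p.1⁻¹ p.2 ∈ T} :=
    (measurable_snd hS).inter (continuous_conj_inv.measurable hT)
  have h1 := Measure.prod_apply (μ := ν) (ν := μ) hE
  have h2 := Measure.prod_apply_symm (μ := ν) (ν := μ) hE
  have h3 : ∀ g : unitary (Matrix (Fin N) (Fin N) ℂ),
      μ (Prod.mk g ⁻¹' {p | p.2 ∈ S ∧ conj p.1⁻¹ p.2 ∈ T}) = μ (S ∩ T) := by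
    intro g
    rw [← measure_preimage_conj μ g⁻¹ (S ∩ T)]
    congr 1
    ext A
    simp [hSinv]
  have h4 : ∀ᵐ A ∂μ, ν ((fun g => (g, A)) ⁻¹' {p | p.2 ∈ S ∧ conj p.1⁻¹ p.2 ∈ T}) =
      S.indicator (fun _ => ν {g | conj g⁻¹ (hermDiag N (basePoint N)) ∈ T}) A := by
    filter_upwards [ae_hankelDet_ne_zero μ] with A hA
    obtain ⟨u, l, hl, rfl⟩ := exists_mem_chamber hA
    by_cases hAS : conj u (hermDiag N l) ∈ S
    · rw [Set.indicator_of_mem hAS, ← measure_preimage_mul ν u⁻¹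
        {g | conj g⁻¹ (hermDiag N (basePoint N)) ∈ T}]
      congr 1
      ext g
      have h : ∀ m, conj g⁻¹ (conj u m) = conj (u⁻¹ * g)⁻¹ m := by
        intro m; rw [mul_inv_rev, inv_inv, conj_mul]
      have h5 : conj g⁻¹ (conj u (hermDiag N l)) ∈ T ↔
          conj (u⁻¹ * g)⁻¹ (hermDiag N (basePoint N)) ∈ T := by
        rw [h]
        exact ⟨hTinv _ l hl _ basePoint_mem, hTinv _ _ basePoint_mem l hl⟩
      exact ⟨fun hg => h5.1 hg.2, fun hg => ⟨hAS, h5.2 hg⟩⟩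
    · rw [Set.indicator_of_notMem hAS]
      simp [hAS]
  simp only [h3, lintegral_const] at h1
  rw [lintegral_congr_ae h4, lintegral_indicator_const hS] at h2
  rw [mul_comm, ← h1, h2]

lemma vandermondeSq_nonneg (l : Fin N → ℝ) : 0 ≤ vandermondeSq N l :=
  Finset.prod_nonneg fun _ _ => Finset.prod_nonneg fun _ _ => sq_nonneg _

lemma continuous_vandermondeSq : Continuous (vandermondeSq N) := by
  unfold vandermondeSq
  fun_prop

lemma continuous_hermDiag : Continuous (hermDiag N) := (diagL (N := N)).continuous

lemma continuous_det_angular :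
    Continuous fun y : OffDiag N => |(angular (gen (y : Herm N))).det| := by
  have h : (fun y : OffDiag N => |(angular (gen (y : Herm N))).det|) = fun y =>
      |(fderiv ℝ param (split N (basePoint N, y))).det| / vandermondeSq N (basePoint N) := by
    ext1 y
    rw [abs_det_fderiv_param, gen_split, diagPart_split,
      mul_div_cancel_left₀ _ (vandermondeSq_ne_zero (basePoint_mem (N := N)).injective)]
  rw [h]
  exact (ContinuousLinearMap.continuous_det.comp ((contDiff_param.continuous_fderiv one_ne_zero).comp
    ((split N).continuous.comp (by fun_prop)))).abs.div_const _

lemma isOpen_cell {W : Set (OffDiag N)} (hW : IsOpen W) : IsOpen (cell W) :=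
  (isOpen_chamber.prod hW).preimage (split N).symm.continuous

lemma exists_measure_inter_image_cell [MeasurableSpace (Herm N)] [BorelSpace (Herm N)]
    (μ : Measure (Herm N)) [μ.IsAddHaarMeasure] {W : Set (OffDiag N)} (hWo : IsOpen W)
    (hW : Set.InjOn (fun y => param (split N (basePoint N, y))) W) :
    ∃ K : ENNReal, ∀ S : Set (Herm N), MeasurableSet S → (∀ u A, conj u A ∈ S ↔ A ∈ S) →
      μ (S ∩ param '' cell W) =
        K * ∫⁻ l in chamber N ∩ hermDiag N ⁻¹' S, ENNReal.ofReal (vandermondeSq N l) := by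
  set P : Measure ((Fin N → ℝ) × OffDiag N) :=
    (volume : Measure (Fin N → ℝ)).prod (Measure.addHaar : Measure (OffDiag N)) with hP
  have hPh : P.IsAddHaarMeasure := by
    have : (Measure.addHaar : Measure (OffDiag N)).IsAddHaarMeasure := inferInstance
    have : SFinite (Measure.addHaar : Measure (OffDiag N)) := inferInstance
    exact Measure.prod.instIsAddHaarMeasure _ _
  have : (P.map (split N)).IsAddHaarMeasure := (split N).isAddHaarMeasure_map P
  obtain ⟨k, hk⟩ : ∃ k : NNReal, μ = k • P.map (split N) :=
    ⟨_, Measure.isAddLeftInvariant_eq_smul μ (P.map (split N))⟩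
  refine ⟨k * ∫⁻ y in W, ENNReal.ofReal |(angular (gen (y : Herm N))).det| ∂Measure.addHaar,
    fun S hS hSinv => ?_⟩
  set D : Set (Herm N) := (fun B => hermDiag N (diagPart B)) ⁻¹' S with hD
  have hDm : MeasurableSet D :=
    (continuous_hermDiag.comp diagPart.continuous).measurable hS
  have h1 : S ∩ param '' cell W = param '' (cell W ∩ D) := by
    rw [Set.inter_comm, ← Set.image_inter_preimage]
    congr 2
    ext B
    exact hSinv _ _
  have hCm : MeasurableSet (cell W ∩ D) := (isOpen_cell hWo).measurableSet.inter hDm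
  have h2 := lintegral_abs_det_fderiv_eq_addHaar_image μ hCm
    (fun x _ => ((contDiff_param.differentiable one_ne_zero x).hasFDerivAt).hasFDerivWithinAt)
    ((injOn_param_cell hW).mono Set.inter_subset_left)
  have h3 : split N ⁻¹' (cell W ∩ D) = (chamber N ∩ hermDiag N ⁻¹' S) ×ˢ W := by
    ext p
    simp only [Set.mem_preimage, Set.mem_inter_iff, split_mem_cell, hD, diagPart_split,
      Set.mem_prod]
    tauto
  have hF : Measurable fun B : Herm N => ENNReal.ofReal |(fderiv ℝ param B).det| :=
    ((ContinuousLinearMap.continuous_det.comp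
      (contDiff_param.continuous_fderiv one_ne_zero)).abs.measurable).ennreal_ofReal
  rw [h1, ← h2, hk, Measure.restrict_smul, lintegral_smul_measure,
    setLIntegral_map hCm hF (split N).continuous.measurable, h3, hP, ← Measure.prod_restrict]
  simp only [abs_det_fderiv_param, diagPart_split, gen_split,
    ENNReal.ofReal_mul (vandermondeSq_nonneg _)]
  rw [lintegral_prod_mul
    (f := fun l => ENNReal.ofReal (vandermondeSq N l))
    (g := fun y : OffDiag N => ENNReal.ofReal |(angular (gen (y : Herm N))).det|)
    continuous_vandermondeSq.measurable.ennreal_ofReal.aemeasurable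
    continuous_det_angular.measurable.ennreal_ofReal.aemeasurable]
  rw [ENNReal.smul_def, smul_eq_mul]
  ring

lemma vandermondeSq_eq_det_sq (l : Fin N → ℝ) :
    vandermondeSq N l = (Matrix.vandermonde l).det ^ 2 := by
  simp only [Matrix.det_vandermonde, vandermondeSq, ← Finset.prod_pow]
  exact Finset.prod_congr rfl fun i _ => Finset.prod_congr rfl fun j _ => by ring

lemma vandermondeSq_comp_perm (l : Fin N → ℝ) (σ : Equiv.Perm (Fin N)) :
    vandermondeSq N (l ∘ σ) = vandermondeSq N l := by
  have h : Matrix.vandermonde (l ∘ σ) = (Matrix.vandermonde l).submatrix σ id := rfl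
  rw [vandermondeSq_eq_det_sq, vandermondeSq_eq_det_sq, h, Matrix.det_permute, mul_pow,
    ← Int.cast_pow, ← Units.val_pow_eq_pow_val, Int.units_sq]
  simp

lemma vandermondeSq_eq_zero {l : Fin N → ℝ} (hl : ¬ Function.Injective l) :
    vandermondeSq N l = 0 := by
  rw [vandermondeSq_eq_det_sq, sq_eq_zero_iff]
  by_contra h
  exact hl (Matrix.det_vandermonde_ne_zero_iff.1 h)

lemma lintegral_eq_factorial_mul_lintegral_chamber {g : (Fin N → ℝ) → ENNReal}
    (hg : Measurable g) (hperm : ∀ (l : Fin N → ℝ) (σ : Equiv.Perm (Fin N)), g (l ∘ σ) = g l)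
    (hzero : ∀ l, ¬ Function.Injective l → g l = 0) :
    ∫⁻ l, g l = (N.factorial : ENNReal) * ∫⁻ l in chamber N, g l := by
  have hcm : MeasurableSet (chamber N) := isOpen_chamber.measurableSet
  have hsum : ∀ l, g l = ∑ σ : Equiv.Perm (Fin N), (chamber N).indicator g (l ∘ σ) := by
    intro l
    by_cases hl : Function.Injective l
    · rw [Finset.sum_eq_single (Tuple.sort l)]
      · rw [Set.indicator_of_mem, hperm]
        exact (Tuple.monotone_sort l).strictMono_of_injective (hl.comp (Equiv.injective _))
      · intro σ _ hσ
        refine Set.indicator_of_notMem (fun h => hσ ?_) _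
        have h1 := Tuple.unique_monotone (StrictMono.monotone h) (Tuple.monotone_sort l)
        exact Equiv.ext fun i => hl (congrFun h1 i)
      · simp
    · rw [hzero l hl]
      refine (Finset.sum_eq_zero fun σ _ => Set.indicator_of_notMem (fun h => hl ?_) _).symm
      exact (Equiv.injective_comp σ l).1 (StrictMono.injective h)
  have hint : ∀ σ : Equiv.Perm (Fin N),
      ∫⁻ l : Fin N → ℝ, (chamber N).indicator g (l ∘ σ) = ∫⁻ l in chamber N, g l := by
    intro σ
    rw [← lintegral_indicator hcm]
    have h := (volume_measurePreserving_piCongrLeft (fun _ : Fin N => ℝ) σ.symm).lintegral_comp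
      (hg.indicator hcm)
    rw [← h]
    refine lintegral_congr fun l => ?_
    congr 1
    ext i
    obtain ⟨j, rfl⟩ := σ.symm.surjective i
    rw [MeasurableEquiv.coe_piCongrLeft, Equiv.piCongrLeft_apply_apply]
    simp
  rw [lintegral_congr hsum, lintegral_finsetSum]
  · simp [hint, Fintype.card_perm]
  · intro σ _
    exact (hg.indicator hcm).comp (measurable_pi_lambda _ fun i => measurable_pi_apply _)

lemma setLIntegral_vandermondeSq_eq {S : Set (Herm N)} [MeasurableSpace (Herm N)]
    [BorelSpace (Herm N)] (hS : MeasurableSet S) (hSinv : ∀ u A, conj u A ∈ S ↔ A ∈ S) :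
    ∫⁻ l in hermDiag N ⁻¹' S, ENNReal.ofReal (vandermondeSq N l) =
      (N.factorial : ENNReal) *
        ∫⁻ l in chamber N ∩ hermDiag N ⁻¹' S, ENNReal.ofReal (vandermondeSq N l) := by
  have hSm : MeasurableSet (hermDiag N ⁻¹' S) := continuous_hermDiag.measurable hS
  have hperm : ∀ (l : Fin N → ℝ) (σ : Equiv.Perm (Fin N)),
      l ∘ σ ∈ hermDiag N ⁻¹' S ↔ l ∈ hermDiag N ⁻¹' S := by
    intro l σ
    obtain ⟨u, hu⟩ := exists_conj_hermDiag_comp l σ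
    rw [Set.mem_preimage, hu, hSinv, Set.mem_preimage]
  rw [Set.inter_comm, ← Measure.restrict_restrict hSm, ← lintegral_indicator hSm,
    ← lintegral_indicator hSm]
  refine lintegral_eq_factorial_mul_lintegral_chamber
    (continuous_vandermondeSq.measurable.ennreal_ofReal.indicator hSm) (fun l σ => ?_)
    fun l hl => ?_
  · by_cases h : l ∈ hermDiag N ⁻¹' S
    · rw [Set.indicator_of_mem h, Set.indicator_of_mem ((hperm l σ).2 h), vandermondeSq_comp_perm]
    · rw [Set.indicator_of_notMem h, Set.indicator_of_notMem (mt (hperm l σ).1 h)]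
  · rw [Set.indicator_apply_eq_zero]
    intro _
    rw [vandermondeSq_eq_zero hl, ENNReal.ofReal_zero]

lemma exists_mul_measure_eq_setLIntegral [MeasurableSpace (Herm N)] [BorelSpace (Herm N)]
    (μ : Measure (Herm N)) [μ.IsAddHaarMeasure] :
    ∃ c K : ENNReal, c ≠ 0 ∧ c ≠ ⊤ ∧
      ∀ S : Set (Herm N), MeasurableSet S → (∀ u A, conj u A ∈ S ↔ A ∈ S) →
        c * μ S = K * ∫⁻ l in hermDiag N ⁻¹' S, ENNReal.ofReal (vandermondeSq N l) := by
  borelize ↥(unitary (Matrix (Fin N) (Fin N) ℂ))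
  obtain ⟨W, hWo, hW0, hW⟩ := exists_window N
  set ν : Measure (unitary (Matrix (Fin N) (Fin N) ℂ)) := Measure.haar
  have hT : MeasurableSet (param '' cell W) :=
    measurable_image_of_fderivWithin (isOpen_cell hWo).measurableSet
      (fun x _ => ((contDiff_param.differentiable one_ne_zero x).hasFDerivAt).hasFDerivWithinAt)
      (injOn_param_cell hW)
  have havg := fun (S : Set (Herm N)) (hS : MeasurableSet S)
    (hSinv : ∀ u A, conj u A ∈ S ↔ A ∈ S) => haar_mul_measure_inter ν μ hS hSinv hT
      fun u l hl m hm => conj_hermDiag_mem_image_cell hl hm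
  obtain ⟨K, hK⟩ := exists_measure_inter_image_cell μ hWo hW
  set c := ν {g | conj g⁻¹ (hermDiag N (basePoint N)) ∈ param '' cell W}
  have hc0 : c ≠ 0 := by
    intro hc
    have h := havg Set.univ MeasurableSet.univ (by simp)
    rw [hc, zero_mul, Set.univ_inter, mul_eq_zero] at h
    rcases h with h | h
    · exact (isOpen_univ.measure_pos ν Set.univ_nonempty).ne' h
    · exact (Measure.measure_pos_of_mem_nhds μ (image_cell_mem_nhds hWo hW0)).ne' h
  refine ⟨(N.factorial : ENNReal) * c, ν Set.univ * K,
    mul_ne_zero (by exact_mod_cast N.factorial_ne_zero) hc0,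
    ENNReal.mul_ne_top (ENNReal.natCast_ne_top _) (measure_ne_top ν _), fun S hS hSinv => ?_⟩
  rw [mul_assoc, ← havg S hS hSinv, hK S hS hSinv, setLIntegral_vandermondeSq_eq hS hSinv]
  ring

/-- The σ-algebra of measurable conjugation-invariant sets of Hermitian matrices. -/
@[reducible] def invariantSigma (N : ℕ) [MeasurableSpace (Herm N)] : MeasurableSpace (Herm N) where
  MeasurableSet' S := MeasurableSet S ∧
    ∀ (u : unitary (Matrix (Fin N) (Fin N) ℂ)) (A : Herm N), conj u A ∈ S ↔ A ∈ S
  measurableSet_empty := ⟨MeasurableSet.empty, by simp⟩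
  measurableSet_compl S hS := ⟨hS.1.compl, fun u A => not_congr (hS.2 u A)⟩
  measurableSet_iUnion S hS := ⟨MeasurableSet.iUnion fun i => (hS i).1, fun u A => by
    simp only [Set.mem_iUnion, (hS _).2 u A]⟩

lemma invariantSigma_le (N : ℕ) [m : MeasurableSpace (Herm N)] : invariantSigma N ≤ m :=
  fun _ hS => hS.1

/-- Weyl integration: up to normalization, a conjugation-invariant integral over Hermitian
matrices is an integral over eigenvalues against the squared Vandermonde density. -/
theorem exists_mul_integral_eq_integral_hermDiag [MeasurableSpace (Herm N)] [BorelSpace (Herm N)]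
    (μ : Measure (Herm N)) [μ.IsAddHaarMeasure] :
    ∃ c K : ℝ, c ≠ 0 ∧ ∀ F : Herm N → ℝ, Measurable F → (∀ u A, F (conj u A) = F A) →
      c * ∫ A, F A ∂μ = K * ∫ l, F (hermDiag N l) * vandermondeSq N l := by
  obtain ⟨c, K, hc0, hct, h⟩ := exists_mul_measure_eq_setLIntegral μ
  refine ⟨c.toReal, K.toReal, ENNReal.toReal_ne_zero.2 ⟨hc0, hct⟩, fun F hF hFinv => ?_⟩
  have hdm : Measurable (hermDiag N) := continuous_hermDiag.measurable
  have hvm : Measurable fun l => ENNReal.ofReal (vandermondeSq N l) :=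
    continuous_vandermondeSq.measurable.ennreal_ofReal
  set ρ : Measure (Herm N) :=
    ((volume : Measure (Fin N → ℝ)).withDensity
      fun l => ENNReal.ofReal (vandermondeSq N l)).map (hermDiag N) with hρ
  have htrim : (c • μ).trim (invariantSigma_le N) = (K • ρ).trim (invariantSigma_le N) := by
    refine @Measure.ext _ (invariantSigma N) _ _ fun S hS => ?_
    rw [trim_measurableSet_eq _ hS, trim_measurableSet_eq _ hS, Measure.smul_apply,
      Measure.smul_apply, smul_eq_mul, smul_eq_mul, h S hS.1 hS.2, hρ,
      Measure.map_apply hdm hS.1, withDensity_apply _ (hdm hS.1)]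
  have hFm : StronglyMeasurable[invariantSigma N] F := by
    have hm : Measurable[invariantSigma N] F := fun B hB =>
      ⟨hF hB, fun u A => by rw [Set.mem_preimage, hFinv, Set.mem_preimage]⟩
    exact hm.stronglyMeasurable
  have h1 : ∫ A, F A ∂(c • μ) = ∫ A, F A ∂(K • ρ) := by
    rw [integral_trim (invariantSigma_le N) hFm, htrim,
      ← integral_trim (invariantSigma_le N) hFm]
  rw [integral_smul_measure, integral_smul_measure, smul_eq_mul, smul_eq_mul, hρ,
    integral_map hdm.aemeasurable hF.aestronglyMeasurable,
    integral_withDensity_eq_integral_toReal_smul hvm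
      (Filter.Eventually.of_forall fun _ => ENNReal.ofReal_lt_top)] at h1
  rw [h1]
  congr 1
  refine integral_congr_ae (Filter.Eventually.of_forall fun l => ?_)
  simp only [ENNReal.toReal_ofReal (vandermondeSq_nonneg l), smul_eq_mul, mul_comm]

end HermitianReduction

/-- Conjugation-invariant Gaussian integrals over Hermitian matrices reduce to eigenvalue
integrals against the squared Vandermonde density:
`(∫ f(A) e^{-Tr A²} dμ)(∫ Δ² e^{-∑λ²} dλ) = (∫ f(diag λ) Δ² e^{-∑λ²} dλ)(∫ e^{-Tr A²} dμ)`. -/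
theorem hermitian_gaussian_eigenvalue_reduction (N : ℕ) (hN : 1 ≤ N)
    [MeasurableSpace (selfAdjoint (Matrix (Fin N) (Fin N) ℂ))]
    [BorelSpace (selfAdjoint (Matrix (Fin N) (Fin N) ℂ))]
    (μ : Measure (selfAdjoint (Matrix (Fin N) (Fin N) ℂ))) [μ.IsAddHaarMeasure]
    (f : selfAdjoint (Matrix (Fin N) (Fin N) ℂ) → ℝ) (hmeas : Measurable f)
    (hinv : ∀ U ∈ Matrix.unitaryGroup (Fin N) ℂ,
      ∀ A B : selfAdjoint (Matrix (Fin N) (Fin N) ℂ),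
        (B : Matrix (Fin N) (Fin N) ℂ) = U * (A : Matrix (Fin N) (Fin N) ℂ) * U⁻¹ →
        f B = f A)
    (hint : Integrable
      (fun A : selfAdjoint (Matrix (Fin N) (Fin N) ℂ) =>
        f A * Real.exp (-(Matrix.trace ((A : Matrix (Fin N) (Fin N) ℂ) *
          (A : Matrix (Fin N) (Fin N) ℂ))).re)) μ) :
    (∫ A, f A * Real.exp (-(Matrix.trace ((A : Matrix (Fin N) (Fin N) ℂ) *
          (A : Matrix (Fin N) (Fin N) ℂ))).re) ∂μ) *
      (∫ l : Fin N → ℝ, vandermondeSq N l * Real.exp (-∑ i, l i ^ 2))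
    = (∫ l : Fin N → ℝ, f (hermDiag N l) * (vandermondeSq N l * Real.exp (-∑ i, l i ^ 2))) *
      (∫ A, Real.exp (-(Matrix.trace ((A : Matrix (Fin N) (Fin N) ℂ) *
          (A : Matrix (Fin N) (Fin N) ℂ))).re) ∂μ) := by
  obtain ⟨c, K, hc, h⟩ := HermitianReduction.exists_mul_integral_eq_integral_hermDiag μ
  set G : selfAdjoint (Matrix (Fin N) (Fin N) ℂ) → ℝ := fun A =>
    Real.exp (-(Matrix.trace ((A : Matrix (Fin N) (Fin N) ℂ) *
      (A : Matrix (Fin N) (Fin N) ℂ))).re) with hG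
  have hGm : Measurable G := by
    refine Continuous.measurable (Real.continuous_exp.comp
      (Complex.continuous_re.comp (Continuous.matrix_trace ?_)).neg)
    exact continuous_subtype_val.mul continuous_subtype_val
  have hGinv : ∀ u A, G (HermitianReduction.conj u A) = G A := by
    intro u A
    have hu : star (u : Matrix (Fin N) (Fin N) ℂ) * u = 1 := (Unitary.mem_iff.1 u.2).1
    have hsq : (HermitianReduction.conj u A : Matrix (Fin N) (Fin N) ℂ) *
        (HermitianReduction.conj u A : Matrix (Fin N) (Fin N) ℂ) =
        u * ((A : Matrix (Fin N) (Fin N) ℂ) * (A : Matrix (Fin N) (Fin N) ℂ) *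
          star (u : Matrix (Fin N) (Fin N) ℂ)) := by
      simp only [HermitianReduction.coe_conj, mul_assoc]
      rw [← mul_assoc (star (u : Matrix (Fin N) (Fin N) ℂ)) u, hu, one_mul]
    simp only [hG]
    rw [hsq, Matrix.trace_mul_comm, mul_assoc, hu, mul_one]
  have hGd : ∀ l, G (hermDiag N l) = Real.exp (-∑ i, l i ^ 2) := by
    intro l
    simp only [hG, HermitianReduction.coe_hermDiag, Matrix.diagonal_mul_diagonal,
      Matrix.trace_diagonal, Complex.re_sum]
    simp [sq]
  have hfinv : ∀ u A, f (HermitianReduction.conj u A) = f A := fun u A =>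
    hinv u u.2 A _ (by
      rw [HermitianReduction.coe_conj,
        Matrix.inv_eq_left_inv (Unitary.mem_iff.1 u.2).1])
  have h1 := h G hGm hGinv
  have h2 := h (fun A => f A * G A) (hmeas.mul hGm) fun u A => by rw [hfinv, hGinv]
  have h3 : ∀ l, vandermondeSq N l * Real.exp (-∑ i, l i ^ 2) =
      G (hermDiag N l) * vandermondeSq N l := fun l => by rw [hGd, mul_comm]
  simp only [h3, ← mul_assoc]
  refine mul_left_cancel₀ hc ?_
  linear_combination (∫ l, G (hermDiag N l) * vandermondeSq N l) * h2
    - (∫ l, f (hermDiag N l) * G (hermDiag N l) * vandermondeSq N l) * h1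
end

section
/- For all real numbers a, z with 0 < a < z, ∫_{−a}^{a} √(a² − x²)/(z − x) dx = π · (z − √(z² − a²)). -/
/-- An antiderivative of `√(a² - x²)/(z - x)` on `(-a, a)`. -/
theorem hasDerivAt_semicircle_resolvent_primitive {a z x : ℝ} (ha : 0 < a) (haz : a < z)
    (hx : x ∈ Set.Ioo (-a) a) :
    HasDerivAt (fun x => z * Real.arcsin (x / a) - Real.sqrt (a ^ 2 - x ^ 2)
        - Real.sqrt (z ^ 2 - a ^ 2) * Real.arcsin ((z * x - a ^ 2) / (a * (z - x))))
      (Real.sqrt (a ^ 2 - x ^ 2) / (z - x)) x := by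
  obtain ⟨hx₁, hx₂⟩ := hx
  have hzx : 0 < z - x := by linarith
  have hax : 0 < a ^ 2 - x ^ 2 := by nlinarith
  have hza : 0 < z ^ 2 - a ^ 2 := by nlinarith
  set s := Real.sqrt (a ^ 2 - x ^ 2) with hs
  set c := Real.sqrt (z ^ 2 - a ^ 2) with hc
  have hs₀ : 0 < s := Real.sqrt_pos.2 hax
  have hc₀ : 0 < c := Real.sqrt_pos.2 hza
  have hs₂ : s ^ 2 = a ^ 2 - x ^ 2 := Real.sq_sqrt hax.le
  have hc₂ : c ^ 2 = z ^ 2 - a ^ 2 := Real.sq_sqrt hza.le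
  have hv : Real.sqrt (1 - (x / a) ^ 2) = s / a := by
    rw [Real.sqrt_eq_iff_mul_self_eq_of_pos (by positivity), ← sq, div_pow, hs₂]
    field_simp
  have hu : Real.sqrt (1 - ((z * x - a ^ 2) / (a * (z - x))) ^ 2) = c * s / (a * (z - x)) := by
    rw [Real.sqrt_eq_iff_mul_self_eq_of_pos (by positivity), ← sq, div_pow, mul_pow c, hs₂, hc₂]
    field_simp
    ring
  have h₁ : HasDerivAt (fun x => Real.arcsin (x / a)) (1 / s) x := by
    have h := (Real.hasDerivAt_arcsin (x := x / a)
      (ne_of_gt (by rw [lt_div_iff₀ ha]; linarith))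
      (ne_of_lt (by rw [div_lt_iff₀ ha]; linarith))).comp x ((hasDerivAt_id x).div_const a)
    rw [hv] at h
    refine h.congr_deriv ?_
    field_simp
  have h₂ : HasDerivAt (fun x => Real.sqrt (a ^ 2 - x ^ 2)) (-x / s) x := by
    have h := (((hasDerivAt_id x).pow 2).const_sub (a ^ 2)).sqrt hax.ne'
    refine h.congr_deriv ?_
    simp only [id, Pi.pow_apply]
    rw [← hs]
    field_simp
    norm_num
  have h₃ : HasDerivAt (fun x => Real.arcsin ((z * x - a ^ 2) / (a * (z - x))))
      (c / ((z - x) * s)) x := by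
    have hd : 0 < a * (z - x) := by positivity
    have h := (Real.hasDerivAt_arcsin (x := (z * x - a ^ 2) / (a * (z - x)))
      (ne_of_gt (by rw [lt_div_iff₀ hd]; nlinarith))
      (ne_of_lt (by rw [div_lt_iff₀ hd]; nlinarith))).comp x
      ((((hasDerivAt_id x).const_mul z).sub_const (a ^ 2)).div
        (((hasDerivAt_id x).const_sub z).const_mul a) hd.ne')
    rw [hu] at h
    refine h.congr_deriv ?_
    simp only [id]
    field_simp
    rw [hc₂]
    ring
  refine (((h₁.const_mul z).sub h₂).sub (h₃.const_mul c)).congr_deriv ?_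
  field_simp
  rw [hs₂, hc₂]
  ring

/-- The resolvent of the Wigner semicircle distribution:
for `0 < a < z`, `∫_{-a}^{a} √(a² - x²)/(z - x) dx = π (z - √(z² - a²))`. -/
theorem semicircle_resolvent_integral (a z : ℝ) (ha : 0 < a) (haz : a < z) :
    ∫ x in (-a)..a, Real.sqrt (a ^ 2 - x ^ 2) / (z - x)
      = Real.pi * (z - Real.sqrt (z ^ 2 - a ^ 2)) := by
  have hle : -a ≤ a := by linarith
  have hne : ∀ x ∈ Set.Icc (-a) a, z - x ≠ 0 := fun x hx => by linarith [hx.2]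
  rw [intervalIntegral.integral_eq_sub_of_hasDerivAt_of_le hle _
    (fun x hx => hasDerivAt_semicircle_resolvent_primitive ha haz hx)]
  · have h₁ : (z * a - a ^ 2) / (a * (z - a)) = 1 := by
      rw [div_eq_one_iff_eq (mul_ne_zero ha.ne' (by linarith))]
      ring
    have h₂ : (z * -a - a ^ 2) / (a * (z - -a)) = -1 := by
      rw [div_eq_iff (mul_ne_zero ha.ne' (by linarith))]
      ring
    rw [h₁, h₂, neg_div, div_self ha.ne', neg_sq, Real.arcsin_neg, Real.arcsin_one]
    ring
  · apply ContinuousOn.intervalIntegrable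
    rw [Set.uIcc_of_le hle]
    exact ContinuousOn.div (by fun_prop) (by fun_prop) hne
  · have hu : ContinuousOn (fun x => (z * x - a ^ 2) / (a * (z - x))) (Set.Icc (-a) a) :=
      ContinuousOn.div (by fun_prop) (by fun_prop) fun x hx => mul_ne_zero ha.ne' (hne x hx)
    have harc := Real.continuous_arcsin.comp_continuousOn hu
    have hv : Continuous fun x => z * Real.arcsin (x / a) - Real.sqrt (a ^ 2 - x ^ 2) :=
      (continuous_const.mul (Real.continuous_arcsin.comp (continuous_id.div_const a))).sub
        (by fun_prop)
    exact hv.continuousOn.sub (continuousOn_const.mul harc)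
end

section
/- For every a > 0 and every s ∈ ℝ, ∫_{−a}^{a} e^{s x} √(a² − x²) dx = (π a²/2) · ∑_{k=0}^{∞} (s a/2)^{2k} / (k! · (k+1)!). (Equivalently, this integral equals (π a/s) I₁(s a) in terms of the modified Bessel function I₁.) -/
/-- The even power moments of the cosine over a half period. -/
theorem integral_cos_pow_even_eq_factorial (k : ℕ) :
    ∫ θ in (0 : ℝ)..Real.pi, Real.cos θ ^ (2 * k)
      = Real.pi * (2 * k).factorial / (4 ^ k * (k.factorial : ℝ) ^ 2) := by
  induction k with
  | zero => simp
  | succ k ih =>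
    rw [show 2 * (k + 1) = 2 * k + 2 by ring, integral_cos_pow, ih]
    simp only [Nat.factorial_succ, Real.sin_pi, Real.sin_zero]
    push_cast
    field_simp
    ring

/-- The even moments of the (unnormalized) semicircle density of radius `a`. -/
theorem integral_pow_even_mul_sqrt_sq_sub_sq {a : ℝ} (ha : 0 ≤ a) (k : ℕ) :
    ∫ x in (-a)..a, x ^ (2 * k) * Real.sqrt (a ^ 2 - x ^ 2)
      = a ^ (2 * k + 2) * (Real.pi * (2 * k).factorial
          / (2 * 4 ^ k * ((k.factorial : ℝ) * ((k + 1).factorial : ℝ)))) := by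
  have hsubst := intervalIntegral.integral_comp_mul_deriv (a := 0) (b := Real.pi)
    (f := fun θ => -(a * Real.cos θ)) (f' := fun θ => a * Real.sin θ)
    (g := fun x => x ^ (2 * k) * Real.sqrt (a ^ 2 - x ^ 2))
    (fun θ _ => ((Real.hasDerivAt_cos θ).const_mul a).fun_neg.congr_deriv (by ring))
    (by fun_prop) (by fun_prop)
  simp only [Real.cos_zero, Real.cos_pi, mul_one, mul_neg, neg_neg] at hsubst
  rw [← hsubst]
  have hcongr : ∫ θ in (0 : ℝ)..Real.pi, ((fun x => x ^ (2 * k) * Real.sqrt (a ^ 2 - x ^ 2)) ∘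
        fun θ => -(a * Real.cos θ)) θ * (a * Real.sin θ)
      = ∫ θ in (0 : ℝ)..Real.pi,
          a ^ (2 * k + 2) * (Real.cos θ ^ (2 * k) - Real.cos θ ^ (2 * (k + 1))) := by
    refine intervalIntegral.integral_congr fun θ hθ => ?_
    rw [Set.uIcc_of_le Real.pi_pos.le] at hθ
    have hsqrt : Real.sqrt (a ^ 2 - (-(a * Real.cos θ)) ^ 2) = a * Real.sin θ := by
      rw [← Real.sqrt_sq (mul_nonneg ha (Real.sin_nonneg_of_mem_Icc hθ))]
      congr 1
      rw [mul_pow a (Real.sin θ), Real.sin_sq]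
      ring
    simp only [Function.comp_apply, hsqrt]
    rw [(even_two_mul k).neg_pow]
    calc (a * Real.cos θ) ^ (2 * k) * (a * Real.sin θ) * (a * Real.sin θ)
        = a ^ (2 * k + 2) * Real.cos θ ^ (2 * k) * Real.sin θ ^ 2 := by ring
      _ = _ := by rw [Real.sin_sq]; ring
  rw [hcongr, intervalIntegral.integral_const_mul, intervalIntegral.integral_sub
    (Continuous.intervalIntegrable (by fun_prop) _ _)
    (Continuous.intervalIntegrable (by fun_prop) _ _),
    integral_cos_pow_even_eq_factorial, integral_cos_pow_even_eq_factorial]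
  congr 1
  rw [show 2 * (k + 1) = 2 * k + 2 by ring]
  simp only [Nat.factorial_succ]
  push_cast
  field_simp
  ring

/-- Against an even weight, the exponential integrates like the hyperbolic cosine. -/
theorem integral_exp_mul_even_eq_integral_cosh_mul {w : ℝ → ℝ} (hw : Continuous w)
    (heven : ∀ x, w (-x) = w x) (a s : ℝ) :
    ∫ x in (-a)..a, Real.exp (s * x) * w x = ∫ x in (-a)..a, Real.cosh (s * x) * w x := by
  have hneg : ∫ x in (-a)..a, Real.exp (-(s * x)) * w x
      = ∫ x in (-a)..a, Real.exp (s * x) * w x := by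
    simpa [heven] using
      intervalIntegral.integral_comp_neg (a := -a) (b := a) fun x => Real.exp (s * x) * w x
  have hcosh : ∀ x, Real.cosh (s * x) * w x
      = (1 / 2) * (Real.exp (s * x) * w x + Real.exp (-(s * x)) * w x) := fun x => by
    rw [Real.cosh_eq]
    ring
  simp only [hcosh]
  rw [intervalIntegral.integral_const_mul, intervalIntegral.integral_add
    (Continuous.intervalIntegrable (by fun_prop) _ _)
    (Continuous.intervalIntegrable (by fun_prop) _ _), hneg]
  ring

/-- Termwise integration of the power series of the hyperbolic cosine against a continuous
weight. -/
theorem hasSum_integral_cosh_mul {w : ℝ → ℝ} (hw : Continuous w) (a b s : ℝ) :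
    HasSum (fun k : ℕ => s ^ (2 * k) / (2 * k).factorial * ∫ x in a..b, x ^ (2 * k) * w x)
      (∫ x in a..b, Real.cosh (s * x) * w x) := by
  have h := intervalIntegral.hasSum_integral_of_dominated_convergence
    (μ := MeasureTheory.volume) (a := a) (b := b)
    (F := fun (k : ℕ) x => (s * x) ^ (2 * k) / (2 * k).factorial * w x)
    (f := fun x => Real.cosh (s * x) * w x)
    (fun k x => (s * x) ^ (2 * k) / (2 * k).factorial * |w x|)
    (fun k => Continuous.aestronglyMeasurable (by fun_prop))
    (fun k => .of_forall fun x _ => by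
      rw [norm_mul, Real.norm_eq_abs, Real.norm_eq_abs, abs_of_nonneg]
      exact div_nonneg ((even_two_mul k).pow_nonneg _) (Nat.cast_nonneg _))
    (.of_forall fun x _ => (Real.hasSum_cosh (s * x)).summable.mul_right _)
    (by
      simp only [fun x => ((Real.hasSum_cosh (s * x)).mul_right |w x|).tsum_eq]
      exact Continuous.intervalIntegrable (by fun_prop) _ _)
    (.of_forall fun x _ => (Real.hasSum_cosh (s * x)).mul_right _)
  refine h.congr_fun fun k => ?_
  rw [← intervalIntegral.integral_const_mul]
  congr 1 with x
  ring

/-- Integrating an exponential against the semicircle density: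
`∫_{-a}^{a} e^{sx} √(a² - x²) dx = (π a²/2) ∑_{k≥0} (sa/2)^{2k}/(k!(k+1)!)`
(equal to `(π a/s) I₁(sa)` in terms of the modified Bessel function `I₁`). -/
theorem semicircle_exponential_integral (a : ℝ) (ha : 0 < a) (s : ℝ) :
    ∫ x in (-a)..a, Real.exp (s * x) * Real.sqrt (a ^ 2 - x ^ 2)
      = Real.pi * a ^ 2 / 2 *
          ∑' k : ℕ, (s * a / 2) ^ (2 * k) / ((k.factorial : ℝ) * ((k + 1).factorial : ℝ)) := by
  have hw : Continuous fun x : ℝ => Real.sqrt (a ^ 2 - x ^ 2) := by fun_prop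
  rw [integral_exp_mul_even_eq_integral_cosh_mul hw (fun x => by simp),
    ← (hasSum_integral_cosh_mul hw (-a) a s).tsum_eq, ← tsum_mul_left]
  refine tsum_congr fun k => ?_
  rw [integral_pow_even_mul_sqrt_sq_sub_sq ha.le, div_pow, mul_pow, pow_mul 2 2 k]
  norm_num only
  field_simp
  ring
end

section
/- Let W(t) = ∑_{j=0}^{∞} (t/4)^j / (j! · (j+1)!) for t > 0 (so that W(t) = (2/√t) I₁(√t)). Then W(t) · √(π/2) · t^{3/4} · e^{−√t} → 1 as t → +∞; that is, W(t) ∼ √(2/π) · t^{−3/4} · e^{√t} at strong coupling. -/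
open MeasureTheory Filter Topology Set

/-- Trigonometric recursion `(n + 2) ∫ cosⁿ sin² = ∫ cosⁿ` over `[0, π]`. -/
theorem integral_cos_pow_mul_sin_sq (n : ℕ) :
    ∫ θ in (0 : ℝ)..Real.pi, Real.cos θ ^ n * Real.sin θ ^ 2 =
      (∫ θ in (0 : ℝ)..Real.pi, Real.cos θ ^ n) / (n + 2) := by
  have hsplit : ∀ θ : ℝ, Real.cos θ ^ n * Real.sin θ ^ 2 =
      Real.cos θ ^ n - Real.cos θ ^ (n + 2) := fun θ ↦ by
    rw [Real.sin_sq]; ring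
  have hn : (n : ℝ) + 2 ≠ 0 := by positivity
  simp_rw [hsplit]
  rw [intervalIntegral.integral_sub (Continuous.intervalIntegrable (by fun_prop) _ _)
    (Continuous.intervalIntegrable (by fun_prop) _ _), integral_cos_pow]
  simp only [Real.sin_pi, Real.sin_zero, mul_zero, sub_zero, zero_div, zero_add]
  field_simp
  ring

theorem integral_cos_pow_add_two_zero_pi (n : ℕ) :
    ∫ θ in (0 : ℝ)..Real.pi, Real.cos θ ^ (n + 2) =
      (n + 1) / (n + 2) * ∫ θ in (0 : ℝ)..Real.pi, Real.cos θ ^ n := by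
  rw [integral_cos_pow]
  simp

theorem integral_cos_pow_odd_zero_pi (j : ℕ) :
    ∫ θ in (0 : ℝ)..Real.pi, Real.cos θ ^ (2 * j + 1) = 0 := by
  induction j with
  | zero => simp
  | succ j ih =>
    rw [show 2 * (j + 1) + 1 = 2 * j + 1 + 2 by ring, integral_cos_pow_add_two_zero_pi, ih,
      mul_zero]

theorem integral_cos_pow_even_zero_pi (j : ℕ) :
    ∫ θ in (0 : ℝ)..Real.pi, Real.cos θ ^ (2 * j) =
      Real.pi * (2 * j).factorial / (4 ^ j * (j.factorial : ℝ) ^ 2) := by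
  induction j with
  | zero => simp
  | succ j ih =>
    rw [show 2 * (j + 1) = 2 * j + 2 by ring, integral_cos_pow_add_two_zero_pi, ih,
      Nat.factorial_succ (2 * j + 1), Nat.factorial_succ (2 * j), Nat.factorial_succ j]
    push_cast
    field_simp
    ring

/-- The even exponential moments of `sin²` are the coefficients of the Wilson loop series. -/
theorem integral_exp_cos_mul_sin_sq_hasSum (x : ℝ) :
    HasSum (fun j : ℕ ↦ Real.pi / 2 *
        ((x ^ 2 / 4) ^ j / ((j.factorial : ℝ) * ((j + 1).factorial : ℝ))))
      (∫ θ in (0 : ℝ)..Real.pi, Real.exp (x * Real.cos θ) * Real.sin θ ^ 2) := by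
  have hsum : HasSum
      (fun n : ℕ ↦ ∫ θ in (0 : ℝ)..Real.pi,
        (x * Real.cos θ) ^ n / n.factorial * Real.sin θ ^ 2)
      (∫ θ in (0 : ℝ)..Real.pi, Real.exp (x * Real.cos θ) * Real.sin θ ^ 2) := by
    refine intervalIntegral.hasSum_integral_of_dominated_convergence
      (fun n _ ↦ |x| ^ n / n.factorial) (fun n ↦ ?_) (fun n ↦ ?_) ?_ ?_ ?_
    · exact Continuous.aestronglyMeasurable (by fun_prop)
    · refine Eventually.of_forall fun θ _ ↦ ?_
      rw [norm_mul, norm_div, norm_pow, norm_pow, norm_mul, Real.norm_natCast]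
      simp only [Real.norm_eq_abs]
      have h1 : |x| * |Real.cos θ| ≤ |x| :=
        mul_le_of_le_one_right (abs_nonneg x) (Real.abs_cos_le_one θ)
      have h2 : |Real.sin θ| ^ 2 ≤ 1 :=
        pow_le_one₀ (abs_nonneg _) (Real.abs_sin_le_one θ)
      refine (mul_le_of_le_one_right (by positivity) h2).trans ?_
      gcongr
    · exact Eventually.of_forall fun θ _ ↦ Real.summable_pow_div_factorial |x|
    · exact intervalIntegrable_const
    · refine Eventually.of_forall fun θ _ ↦ HasSum.mul_right _ ?_
      rw [Real.exp_eq_exp_ℝ]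
      exact NormedSpace.expSeries_div_hasSum_exp _
  have hterm : ∀ n : ℕ, ∫ θ in (0 : ℝ)..Real.pi,
      (x * Real.cos θ) ^ n / n.factorial * Real.sin θ ^ 2 =
      x ^ n / n.factorial * ((∫ θ in (0 : ℝ)..Real.pi, Real.cos θ ^ n) / (n + 2)) := fun n ↦ by
    rw [← integral_cos_pow_mul_sin_sq, ← intervalIntegral.integral_const_mul]
    congr 1 with θ
    ring
  simp_rw [hterm] at hsum
  have hinj : Function.Injective fun j : ℕ ↦ 2 * j := fun a b h ↦ by simpa using h
  rw [← hinj.hasSum_iff] at hsum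
  · convert hsum using 2 with j
    simp only [Function.comp_apply]
    rw [integral_cos_pow_even_zero_pi, Nat.factorial_succ j]
    push_cast
    rw [div_pow, ← pow_mul]
    field_simp
  · intro n hn
    obtain ⟨j, rfl⟩ : Odd n := by
      rw [← Nat.not_even_iff_odd]
      rintro ⟨j, rfl⟩
      exact hn ⟨j, two_mul j⟩
    rw [integral_cos_pow_odd_zero_pi, zero_div, mul_zero]

/-- Substituting `s = x (1 - cos θ)` turns the trigonometric integral into a Laplace integral;
the truncation at `s = 2 x` is performed by the real square root. -/
theorem integral_exp_cos_mul_sin_sq_eq {x : ℝ} (hx : 0 < x) :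
    x * √x * Real.exp (-x) *
        ∫ θ in (0 : ℝ)..Real.pi, Real.exp (x * Real.cos θ) * Real.sin θ ^ 2 =
      ∫ s in Ioi (0 : ℝ), Real.exp (-s) * √(s * (2 - s / x)) := by
  have hsub := intervalIntegral.integral_comp_mul_deriv (a := 0) (b := Real.pi)
    (f := fun θ ↦ x * (1 - Real.cos θ)) (f' := fun θ ↦ x * Real.sin θ)
    (g := fun s ↦ Real.exp (-s) * √(s * (2 - s / x)))
    (fun θ _ ↦ by
      simpa using ((Real.hasDerivAt_cos θ).const_sub 1).const_mul x)
    (by fun_prop) (by fun_prop)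
  have htrunc : ∫ s in Ioi (0 : ℝ), Real.exp (-s) * √(s * (2 - s / x)) =
      ∫ s in Ioc (0 : ℝ) (2 * x), Real.exp (-s) * √(s * (2 - s / x)) := by
    refine setIntegral_eq_of_subset_of_forall_sdiff_eq_zero measurableSet_Ioi
      Ioc_subset_Ioi_self fun s hs ↦ ?_
    have hs0 : 0 < s := hs.1
    have hs2 : 2 * x < s := by
      by_contra! h
      exact hs.2 ⟨hs0, h⟩
    have : 2 < s / x := by rwa [lt_div_iff₀ hx]
    rw [Real.sqrt_eq_zero_of_nonpos (mul_nonpos_of_nonneg_of_nonpos hs0.le (by linarith)),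
      mul_zero]
  rw [htrunc, ← intervalIntegral.integral_of_le (by positivity),
    ← intervalIntegral.integral_const_mul]
  simp only [Real.cos_zero, Real.cos_pi, sub_self, mul_zero, sub_neg_eq_add] at hsub
  rw [show 2 * x = x * (1 + 1) by ring, ← hsub]
  refine intervalIntegral.integral_congr fun θ hθ ↦ ?_
  rw [uIcc_of_le Real.pi_pos.le] at hθ
  have hsin : 0 ≤ Real.sin θ := Real.sin_nonneg_of_mem_Icc hθ
  have hroot : x * (1 - Real.cos θ) * (2 - x * (1 - Real.cos θ) / x) =
      x * Real.sin θ ^ 2 := by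
    rw [mul_div_cancel_left₀ _ hx.ne', Real.sin_sq]
    ring
  simp only [Function.comp_apply]
  rw [hroot, Real.sqrt_mul hx.le, Real.sqrt_sq hsin,
    show -(x * (1 - Real.cos θ)) = -x + x * Real.cos θ by ring, Real.exp_add]
  ring

theorem integral_exp_neg_mul_sqrt :
    ∫ s in Ioi (0 : ℝ), Real.exp (-s) * √s = √Real.pi / 2 := by
  have h := Real.Gamma_eq_integral (s := 3 / 2) (by norm_num)
  rw [show (3 / 2 : ℝ) = 1 / 2 + 1 by norm_num, Real.Gamma_add_one (by norm_num),
    Real.Gamma_one_half_eq] at h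
  simp only [add_sub_cancel_right, ← Real.sqrt_eq_rpow] at h
  rw [← h]
  ring

theorem integrableOn_exp_neg_mul_sqrt :
    IntegrableOn (fun s : ℝ ↦ Real.exp (-s) * √s) (Ioi 0) := by
  have h := Real.GammaIntegral_convergent (s := 3 / 2) (by norm_num)
  norm_num [← Real.sqrt_eq_rpow] at h
  simpa only [Real.sqrt_eq_rpow] using h

theorem tendsto_integral_exp_neg_mul_sqrt :
    Tendsto (fun x : ℝ ↦ ∫ s in Ioi (0 : ℝ), Real.exp (-s) * √(s * (2 - s / x))) atTop
      (𝓝 (√2 * (√Real.pi / 2))) := by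
  rw [← integral_exp_neg_mul_sqrt, ← integral_const_mul]
  refine tendsto_integral_filter_of_dominated_convergence
    (fun s ↦ √2 * (Real.exp (-s) * √s)) (Eventually.of_forall fun x ↦ ?_) ?_ ?_ ?_
  · exact Continuous.aestronglyMeasurable (by fun_prop)
  · filter_upwards [eventually_gt_atTop 0] with x hx
    filter_upwards [ae_restrict_mem measurableSet_Ioi] with s hs
    have hs0 : 0 < s := hs
    rw [Real.norm_of_nonneg (by positivity), mul_left_comm, ← Real.sqrt_mul (by norm_num)]
    refine mul_le_mul_of_nonneg_left (Real.sqrt_le_sqrt ?_) (Real.exp_pos _).le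
    nlinarith [mul_pos hs0 (div_pos hs0 hx)]
  · exact integrableOn_exp_neg_mul_sqrt.const_mul _
  · refine Eventually.of_forall fun s ↦ ?_
    have hlim : Tendsto (fun x : ℝ ↦ s * (2 - s / x)) atTop (𝓝 (s * (2 - 0))) :=
      (tendsto_const_nhds.sub (tendsto_const_nhds.div_atTop tendsto_id)).const_mul s
    rw [mul_left_comm, ← Real.sqrt_mul (by norm_num)]
    convert (hlim.sqrt).const_mul (Real.exp (-s)) using 3
    ring_nf


/-- Strong-coupling asymptotics of the planar circular Wilson loop
`W(t) = ∑_{j≥0} (t/4)^j/(j!(j+1)!)`: as `t → +∞`,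
`W(t) √(π/2) t^{3/4} e^{-√t} → 1`, i.e. `W(t) ~ √(2/π) t^{-3/4} e^{√t}`. -/
theorem wilson_loop_strong_coupling_asymptotics :
    Filter.Tendsto
      (fun t : ℝ =>
        (∑' j : ℕ, (t / 4) ^ j / ((j.factorial : ℝ) * ((j + 1).factorial : ℝ))) *
          Real.sqrt (Real.pi / 2) * t ^ ((3 : ℝ) / 4) * Real.exp (-Real.sqrt t))
      Filter.atTop (nhds 1) := by
  have hlim := (tendsto_integral_exp_neg_mul_sqrt.comp Real.tendsto_sqrt_atTop).const_mul
    (2 / Real.pi * √(Real.pi / 2))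
  have hone : 2 / Real.pi * √(Real.pi / 2) * (√2 * (√Real.pi / 2)) = 1 := by
    have h2 : √(2 : ℝ) ≠ 0 := by positivity
    rw [Real.sqrt_div Real.pi_pos.le]
    field_simp
    exact Real.sq_sqrt Real.pi_pos.le
  rw [hone] at hlim
  refine hlim.congr' ?_
  filter_upwards [eventually_gt_atTop 0] with t ht
  have hx : 0 < √t := Real.sqrt_pos.2 ht
  have hW := (integral_exp_cos_mul_sin_sq_hasSum √t).tsum_eq
  rw [tsum_mul_left, Real.sq_sqrt ht.le] at hW
  have hpow : t ^ ((3 : ℝ) / 4) = √t * √√t := by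
    rw [Real.sqrt_eq_rpow √t, Real.sqrt_eq_rpow t, ← Real.rpow_mul ht.le, ← Real.rpow_add ht]
    norm_num
  rw [Function.comp_apply, ← integral_exp_cos_mul_sin_sq_eq hx, ← hW, hpow]
  field_simp
end

section
/- Fix an integer g ≥ 1 and for x > 0 set Z(x) = (2π²)^{1−g} · ∑_{n=1}^{∞} e^{−x π² n²} / n^{2g−2}. Then for every ε > 0, the (g−1)-st derivative of Z at ε equals ((−1)^{g−1}/2^g) · (−1 + (πε)^{−1/2} · ∑_{k∈ℤ} e^{−k²/ε}). -/
open Set in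
theorem hasDerivAt_tsum_mul_exp_neg {a b : ℕ → ℝ} {A C : ℝ} (ha : ∀ n, |a n| ≤ A)
    (hab : ∀ n, |a n * b n| ≤ C) (hb : ∀ n, 0 ≤ b n)
    (hs : ∀ x : ℝ, 0 < x → Summable fun n => Real.exp (-x * b n)) {x : ℝ} (hx : 0 < x) :
    HasDerivAt (fun x : ℝ => ∑' n, a n * Real.exp (-x * b n))
      (∑' n, -(a n * b n) * Real.exp (-x * b n)) x := by
  have hx2 : x ∈ Ioi (x / 2) := by simp only [mem_Ioi]; linarith
  refine hasDerivAt_tsum_of_isPreconnected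
    (g := fun n x => a n * Real.exp (-x * b n))
    (g' := fun n x => -(a n * b n) * Real.exp (-x * b n))
    ((hs (x / 2) (by positivity)).mul_left C) isOpen_Ioi
    isPreconnected_Ioi (fun n y _ => ?_) (fun n y hy => ?_) hx2 ?_ hx2
  · have h : HasDerivAt (fun y : ℝ => -y * b n) (-1 * b n) y :=
      (hasDerivAt_id y).neg.mul_const (b n)
    exact (h.exp.const_mul (a n)).congr_deriv (by ring)
  · rw [Real.norm_eq_abs, abs_mul, abs_neg, Real.abs_exp]
    have hy' : x / 2 ≤ y := le_of_lt hy
    exact mul_le_mul (hab n)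
      (Real.exp_le_exp.2 (by nlinarith [hb n])) (Real.exp_pos _).le ((abs_nonneg _).trans (hab n))
  · refine Summable.of_norm_bounded ((hs x hx).mul_left A) fun n => ?_
    rw [Real.norm_eq_abs, abs_mul, Real.abs_exp]
    exact mul_le_mul_of_nonneg_right (ha n) (Real.exp_pos _).le

theorem summable_exp_neg_mul_sq_nat_add_one {c : ℝ} (hc : 0 < c) :
    Summable fun n : ℕ => Real.exp (-c * ((n : ℝ) + 1) ^ 2) := by
  refine Summable.of_nonneg_of_le (fun _ => (Real.exp_pos _).le) (fun n => ?_)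
    (Real.summable_exp_nat_mul_iff.2 (neg_lt_zero.2 hc))
  refine Real.exp_le_exp.2 ?_
  have hn : (0 : ℝ) ≤ n := n.cast_nonneg
  nlinarith [mul_nonneg hc.le hn, mul_nonneg hc.le (sq_nonneg (n : ℝ))]

theorem iteratedDeriv_tsum_exp_neg_sq_div_pow {c : ℝ} (hc : 0 < c) (m k : ℕ) {x : ℝ} (hx : 0 < x) :
    iteratedDeriv k (fun x : ℝ => ∑' n : ℕ,
      Real.exp (-x * c * ((n : ℝ) + 1) ^ 2) / ((n : ℝ) + 1) ^ (2 * (m + k))) x =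
      (-c) ^ k * ∑' n : ℕ, Real.exp (-x * c * ((n : ℝ) + 1) ^ 2) / ((n : ℝ) + 1) ^ (2 * m) := by
  induction k generalizing m x with
  | zero => simp
  | succ k ih =>
    have hev : iteratedDeriv k (fun x : ℝ => ∑' n : ℕ,
          Real.exp (-x * c * ((n : ℝ) + 1) ^ 2) / ((n : ℝ) + 1) ^ (2 * (m + (k + 1))))
        =ᶠ[nhds x] fun x => (-c) ^ k * ∑' n : ℕ,
          (((n : ℝ) + 1) ^ (2 * (m + 1)))⁻¹ * Real.exp (-x * (c * ((n : ℝ) + 1) ^ 2)) := by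
      filter_upwards [lt_mem_nhds hx] with y hy
      rw [show m + (k + 1) = m + 1 + k by ring, ih (m + 1) hy]
      simp only [div_eq_inv_mul, mul_assoc]
    have hpow (n j : ℕ) : |(((n : ℝ) + 1) ^ j)⁻¹| ≤ 1 := by
      rw [abs_of_nonneg (by positivity)]
      exact inv_le_one_of_one_le₀ (one_le_pow₀ (by linarith [n.cast_nonneg (α := ℝ)]))
    have hcancel (n : ℕ) : (((n : ℝ) + 1) ^ (2 * (m + 1)))⁻¹ * (c * ((n : ℝ) + 1) ^ 2) =
        c * (((n : ℝ) + 1) ^ (2 * m))⁻¹ := by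
      have : (n : ℝ) + 1 ≠ 0 := by positivity
      field_simp
      ring
    have hd := hasDerivAt_tsum_mul_exp_neg (A := 1) (C := c)
      (a := fun n : ℕ => (((n : ℝ) + 1) ^ (2 * (m + 1)))⁻¹)
      (b := fun n : ℕ => c * ((n : ℝ) + 1) ^ 2) (fun n => hpow n _)
      (fun n => by
        rw [hcancel, abs_mul, abs_of_pos hc]
        exact mul_le_of_le_one_right hc.le (hpow n _))
      (fun n => by positivity)
      (fun y hy => by
        simpa only [neg_mul, mul_assoc] using
          summable_exp_neg_mul_sq_nat_add_one (mul_pos hy hc)) hx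
    rw [iteratedDeriv_succ, hev.deriv_eq, (hd.const_mul _).deriv, pow_succ, mul_assoc,
      ← tsum_mul_left (a := -c)]
    congr 2
    ext n
    rw [hcancel]
    ring_nf

theorem tsum_exp_neg_mul_sq_nat_add_one {c : ℝ} (hc : 0 < c) :
    ∑' n : ℕ, Real.exp (-c * ((n : ℝ) + 1) ^ 2) =
      (-1 + ∑' k : ℤ, Real.exp (-c * (k : ℝ) ^ 2)) / 2 := by
  have hs := summable_exp_neg_mul_sq_nat_add_one hc
  have h := tsum_of_add_one_of_neg_add_one (f := fun k : ℤ => Real.exp (-c * (k : ℝ) ^ 2))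
    (by simpa using hs) (by simpa [← neg_add_rev, add_comm] using hs)
  have hneg (n : ℕ) : (-((n : ℝ) + 1)) ^ 2 = ((n : ℝ) + 1) ^ 2 := neg_sq _
  rw [h]
  push_cast
  simp only [hneg]
  norm_num
  ring

theorem tsum_exp_neg_mul_pi_sq_int_sq {ε : ℝ} (hε : 0 < ε) :
    ∑' k : ℤ, Real.exp (-(ε * Real.pi ^ 2) * (k : ℝ) ^ 2) =
      (Real.pi * ε) ^ (-(1 / 2) : ℝ) * ∑' k : ℤ, Real.exp (-(k : ℝ) ^ 2 / ε) := by
  have hpe : 0 < Real.pi * ε := mul_pos Real.pi_pos hε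
  have h := Real.tsum_exp_neg_mul_int_sq hpe
  rw [Real.rpow_neg hpe.le, ← one_div]
  convert h using 5 with k k
  · ring
  · field_simp

/-- The (g-1)-st derivative of the genus-g SU(2) two-dimensional Yang-Mills partition
function `Z(x) = (2π²)^{1-g} ∑_{n≥1} e^{-xπ²n²}/n^{2g-2}`, computed at `ε > 0` via Poisson
summation: it equals `((-1)^{g-1}/2^g)(-1 + (πε)^{-1/2} ∑_{k∈ℤ} e^{-k²/ε})`. -/
theorem su2_ym_partition_function_derivative (g : ℕ) (hg : 1 ≤ g) (ε : ℝ) (hε : 0 < ε) :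
    iteratedDeriv (g - 1)
      (fun x : ℝ =>
        (2 * Real.pi ^ 2) ^ (1 - (g : ℤ)) *
          ∑' n : ℕ, Real.exp (-x * Real.pi ^ 2 * ((n : ℝ) + 1) ^ 2) /
            ((n : ℝ) + 1) ^ (2 * g - 2)) ε
      = (-1 : ℝ) ^ (g - 1) / 2 ^ g *
          (-1 + (Real.pi * ε) ^ (-(1 / 2) : ℝ) * ∑' k : ℤ, Real.exp (-(k : ℝ) ^ 2 / ε)) := by
  obtain ⟨m, rfl⟩ : ∃ m, g = m + 1 := ⟨g - 1, by omega⟩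
  have hderiv := iteratedDeriv_tsum_exp_neg_sq_div_pow (pow_pos Real.pi_pos 2) 0 m hε
  rw [show m + 1 - 1 = m by omega, show 2 * (m + 1) - 2 = 2 * (0 + m) by omega,
    iteratedDeriv_const_mul_field, hderiv,
    ← tsum_exp_neg_mul_pi_sq_int_sq hε]
  have hsum := tsum_exp_neg_mul_sq_nat_add_one (mul_pos hε (pow_pos Real.pi_pos 2))
  simp only [mul_zero, pow_zero, div_one, ← neg_mul] at hsum ⊢
  rw [hsum, show (1 : ℤ) - ((m + 1 : ℕ) : ℤ) = -(m : ℤ) by push_cast; ring, zpow_neg, zpow_natCast,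
    neg_pow, mul_pow]
  have : (Real.pi ^ 2) ^ m ≠ 0 := by positivity
  field_simp
  ring
end

section
/- Fix an integer g ≥ 1 and for x > 0 set Z(x) = (8π²)^{1−g} · ∑_{n=1}^{∞} (−1)^{n+1} e^{−π² x n²} / n^{2g−2}. Then for every ε > 0, the (g−1)-st derivative of Z at ε equals ((−1)^g/(2·8^{g−1})) · (−1 + (πε)^{−1/2} · ∑_{k∈ℤ} e^{−(k+1/2)²/ε}). In particular every term e^{−(k+1/2)²/ε} is exponentially small as ε → 0⁺, so Z(ε) agrees with a polynomial of degree g−2 in ε up to exponentially small corrections. -/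
open Filter Topology

/-- Termwise differentiation of a Dirichlet-type series `∑ c n * exp (-b n * x)` on `x > 0`. -/
theorem iteratedDeriv_tsum_mul_exp_neg {ι : Type*} {c b : ι → ℝ} (hb : ∀ n, 0 ≤ b n)
    (hs : ∀ (j : ℕ) (δ : ℝ), 0 < δ → Summable fun n => |c n| * b n ^ j * Real.exp (-b n * δ))
    (j : ℕ) {x : ℝ} (hx : 0 < x) :
    iteratedDeriv j (fun y : ℝ => ∑' n, c n * Real.exp (-b n * y)) x =
      ∑' n, c n * (-b n) ^ j * Real.exp (-b n * x) := by
  induction j generalizing x with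
  | zero => simp
  | succ j ih =>
    have heq : iteratedDeriv j (fun y : ℝ => ∑' n, c n * Real.exp (-b n * y)) =ᶠ[𝓝 x]
        fun y => ∑' n, c n * (-b n) ^ j * Real.exp (-b n * y) := by
      filter_upwards [lt_mem_nhds hx] with y hy using ih hy
    rw [iteratedDeriv_succ, heq.deriv_eq]
    refine (hasDerivAt_tsum_of_isPreconnected
      (g := fun n y => c n * (-b n) ^ j * Real.exp (-b n * y))
      (g' := fun n y => c n * (-b n) ^ (j + 1) * Real.exp (-b n * y)) (hs (j + 1) (x / 2) (by positivity))
      (isOpen_Ioi (a := x / 2)) isPreconnected_Ioi ?_ ?_ (half_lt_self hx) ?_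
      (half_lt_self hx)).deriv
    · intro n y _
      have h : HasDerivAt (fun z => -b n * z) (-b n) y := by
        simpa using (hasDerivAt_id y).const_mul (-b n)
      exact (h.exp.const_mul (c n * (-b n) ^ j)).congr_deriv (by ring)
    · intro n y hy
      rw [norm_mul, norm_mul, norm_pow, norm_neg, Real.norm_eq_abs, Real.norm_eq_abs,
        Real.norm_eq_abs, Real.abs_exp, abs_of_nonneg (hb n)]
      have hbn := hb n
      refine mul_le_mul_of_nonneg_left (Real.exp_le_exp.2 ?_) (by positivity)
      nlinarith [mul_le_mul_of_nonneg_left (le_of_lt (Set.mem_Ioi.1 hy)) hbn]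
    · refine Summable.of_norm ((hs j x hx).congr fun n => ?_)
      simp [abs_of_nonneg (hb n)]

theorem summable_sq_pow_mul_exp_neg_sq {a : ℝ} (ha : 0 < a) (j : ℕ) :
    Summable fun n : ℕ => ((n : ℝ) ^ 2) ^ j * Real.exp (-a * (n : ℝ) ^ 2) := by
  refine (Real.summable_pow_mul_exp_neg_nat_mul (2 * j) ha).of_nonneg_of_le
    (fun n => by positivity) fun n => ?_
  rw [← pow_mul]
  gcongr _ * Real.exp ?_
  have : (n : ℝ) ≤ (n : ℝ) ^ 2 := by exact_mod_cast Nat.le_self_pow two_ne_zero n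
  nlinarith

/-- Poisson summation for the alternating theta series. -/
theorem tsum_int_alternating_exp_neg_sq {ε : ℝ} (hε : 0 < ε) :
    ∑' n : ℤ, (-1 : ℝ) ^ n * Real.exp (-(Real.pi ^ 2 * ε) * (n : ℝ) ^ 2) =
      (Real.pi * ε) ^ (-(1 / 2) : ℝ) *
        ∑' k : ℤ, Real.exp (-((k : ℝ) + 1 / 2) ^ 2 / ε) := by
  have hpe : 0 < Real.pi * ε := by positivity
  have h := Complex.tsum_exp_neg_quadratic (a := ((Real.pi * ε : ℝ) : ℂ))
    (by rwa [Complex.ofReal_re]) (-Complex.I / 2)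
  rw [← Complex.ofReal_inj]
  push_cast
  rw [Complex.ofReal_cpow hpe.le]
  push_cast at h ⊢
  convert h using 1
  · refine tsum_congr fun n => ?_
    rw [Complex.exp_add, mul_comm]
    congr 1
    · congr 1; ring
    · rw [← show Complex.exp (-(Real.pi * Complex.I)) = -1 by simp [Complex.exp_neg],
        ← Complex.exp_int_mul]
      congr 1
      ring
  · congr 1
    · simp [Complex.cpow_neg]
    · refine tsum_congr fun n => ?_
      congr 1
      have : (ε : ℂ) ≠ 0 := by exact_mod_cast hε.ne'
      have : (Real.pi : ℂ) ≠ 0 := by exact_mod_cast Real.pi_ne_zero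
      field_simp
      ring_nf
      simp
      ring

theorem tsum_int_alternating_exp_neg_sq_eq_tsum_nat {a : ℝ} (ha : 0 < a) :
    ∑' n : ℤ, (-1 : ℝ) ^ n * Real.exp (-a * (n : ℝ) ^ 2) =
      1 - 2 * ∑' n : ℕ, (-1 : ℝ) ^ n * Real.exp (-a * ((n : ℝ) + 1) ^ 2) := by
  have hs : Summable fun n : ℕ => (-1 : ℝ) ^ n * Real.exp (-a * (n : ℝ) ^ 2) :=
    Summable.of_norm (by simpa using summable_sq_pow_mul_exp_neg_sq ha 0)
  have hs' : Summable fun n : ℕ => (-1 : ℝ) ^ (n + 1) * Real.exp (-a * ((n : ℝ) + 1) ^ 2) := by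
    simpa using (summable_nat_add_iff 1).2 hs
  have hneg (n : ℕ) : (-1 : ℝ) ^ (-((n : ℤ) + 1)) * Real.exp (-a * ((-((n : ℤ) + 1) : ℤ) : ℝ) ^ 2)
      = (-1 : ℝ) ^ (n + 1) * Real.exp (-a * ((n : ℝ) + 1) ^ 2) := by
    rw [zpow_neg, ← inv_zpow]
    push_cast
    rw [neg_sq, inv_neg_one]
    norm_cast
  rw [tsum_of_nat_of_neg_add_one (by simpa using hs) (by simpa only [hneg] using hs')]
  simp only [hneg, zpow_natCast, Int.cast_natCast]
  rw [hs.tsum_eq_zero_add]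
  simp only [Nat.cast_add, Nat.cast_one, pow_succ, mul_neg, mul_one, neg_mul, tsum_neg]
  simp
  ring

theorem tendsto_exp_neg_div_div_pow {c : ℝ} (hc : 0 < c) (m : ℕ) :
    Tendsto (fun e : ℝ => Real.exp (-c / e) / e ^ m) (𝓝[>] 0) (𝓝 0) := by
  have h := ((Real.tendsto_pow_mul_exp_neg_atTop_nhds_zero m).comp
    (tendsto_inv_nhdsGT_zero.const_mul_atTop hc)).const_mul ((c ^ m)⁻¹)
  rw [mul_zero] at h
  refine h.congr fun e => ?_
  simp only [Function.comp_apply]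
  rw [mul_pow, ← neg_mul, ← div_eq_mul_inv (-c), inv_pow]
  field_simp

/-- The (g-1)-st derivative of the genus-g SO(3) two-dimensional Yang-Mills partition
function on a nontrivial bundle, `Z(x) = (8π²)^{1-g} ∑_{n≥1} (-1)^{n+1} e^{-π²xn²}/n^{2g-2}`,
computed at `ε > 0` via Poisson summation:
it equals `((-1)^g/(2·8^{g-1}))(-1 + (πε)^{-1/2} ∑_{k∈ℤ} e^{-(k+1/2)²/ε})`;
and every term `e^{-(k+1/2)²/ε}` is exponentially small as `ε → 0⁺` (smaller than any
power of `ε`). -/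
theorem so3_ym_partition_function_derivative (g : ℕ) (hg : 1 ≤ g) (ε : ℝ) (hε : 0 < ε) :
    iteratedDeriv (g - 1)
      (fun x : ℝ =>
        (8 * Real.pi ^ 2) ^ (1 - (g : ℤ)) *
          ∑' n : ℕ, (-1 : ℝ) ^ (n + 1 + 1) *
            Real.exp (-Real.pi ^ 2 * x * ((n : ℝ) + 1) ^ 2) / ((n : ℝ) + 1) ^ (2 * g - 2)) ε
      = (-1 : ℝ) ^ g / (2 * 8 ^ (g - 1)) *
          (-1 + (Real.pi * ε) ^ (-(1 / 2) : ℝ) *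
            ∑' k : ℤ, Real.exp (-((k : ℝ) + 1 / 2) ^ 2 / ε)) ∧
    ∀ k : ℤ, ∀ m : ℕ,
      Filter.Tendsto (fun e : ℝ => Real.exp (-((k : ℝ) + 1 / 2) ^ 2 / e) / e ^ m)
        (nhdsWithin 0 (Set.Ioi 0)) (nhds 0) := by
  refine ⟨?_, fun k m => tendsto_exp_neg_div_div_pow (sq_pos_of_ne_zero fun h => ?_) m⟩
  · obtain ⟨p, rfl⟩ := Nat.exists_eq_add_of_le' hg
    have hp : 2 * (p + 1) - 2 = 2 * p := by omega
    have hz : (1 : ℤ) - ((p + 1 : ℕ) : ℤ) = -(p : ℤ) := by push_cast; ring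
    rw [iteratedDeriv_const_mul_field, ← tsum_int_alternating_exp_neg_sq hε,
      tsum_int_alternating_exp_neg_sq_eq_tsum_nat (by positivity), hp, hz, Nat.add_sub_cancel]
    have hfun : (fun x : ℝ => ∑' n : ℕ, (-1 : ℝ) ^ (n + 1 + 1) *
          Real.exp (-Real.pi ^ 2 * x * ((n : ℝ) + 1) ^ 2) / ((n : ℝ) + 1) ^ (2 * p)) =
        fun x => ∑' n : ℕ, ((-1 : ℝ) ^ n / ((n : ℝ) + 1) ^ (2 * p)) *
          Real.exp (-(Real.pi ^ 2 * ((n : ℝ) + 1) ^ 2) * x) := by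
      funext x
      refine tsum_congr fun n => ?_
      rw [show -Real.pi ^ 2 * x * ((n : ℝ) + 1) ^ 2 = -(Real.pi ^ 2 * ((n : ℝ) + 1) ^ 2) * x by
        ring]
      ring
    rw [hfun, iteratedDeriv_tsum_mul_exp_neg (fun n => by positivity) _ p hε]
    · have hterm (n : ℕ) : (-1 : ℝ) ^ n / ((n : ℝ) + 1) ^ (2 * p) *
          (-(Real.pi ^ 2 * ((n : ℝ) + 1) ^ 2)) ^ p *
            Real.exp (-(Real.pi ^ 2 * ((n : ℝ) + 1) ^ 2) * ε) =
          (-Real.pi ^ 2) ^ p *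
            ((-1 : ℝ) ^ n * Real.exp (-(Real.pi ^ 2 * ε) * ((n : ℝ) + 1) ^ 2)) := by
        rw [← neg_mul, mul_pow, pow_mul,
          show -Real.pi ^ 2 * ((n : ℝ) + 1) ^ 2 * ε = -(Real.pi ^ 2 * ε) * ((n : ℝ) + 1) ^ 2 by
            ring]
        field_simp
      simp only [hterm, tsum_mul_left]
      rw [zpow_neg, zpow_natCast, mul_pow, neg_pow (Real.pi ^ 2), pow_succ]
      field_simp
      ring
    · intro j δ hδ
      have h := ((summable_nat_add_iff 1).2 (summable_sq_pow_mul_exp_neg_sq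
        (a := Real.pi ^ 2 * δ) (by positivity) j)).mul_left ((Real.pi ^ 2) ^ j)
      refine h.of_nonneg_of_le (fun n => by positivity) fun n => ?_
      have h1 : |(-1 : ℝ) ^ n / ((n : ℝ) + 1) ^ (2 * p)| ≤ 1 := by
        rw [abs_div, abs_pow, abs_neg, abs_one, one_pow, abs_of_pos (by positivity)]
        exact div_le_one_of_le₀ (one_le_pow₀ (by simp)) (by positivity)
      calc _ ≤ 1 * (Real.pi ^ 2 * ((n : ℝ) + 1) ^ 2) ^ j *
            Real.exp (-(Real.pi ^ 2 * ((n : ℝ) + 1) ^ 2) * δ) := by gcongr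
        _ = _ := by
          rw [one_mul, mul_pow, mul_assoc]
          push_cast
          congr 3
          ring
  · have h2 : (2 * k + 1 : ℝ) = 0 := by linarith
    have h3 : 2 * k + 1 = 0 := by exact_mod_cast h2
    omega
end

section
/- For every z ∈ ℂ, the family n ↦ (1 − z²/n²)ⁿ · exp(z²/n), indexed by the positive integers, is multipliable: the infinite product ∏_{n=1}^{∞} (1 − z²/n²)ⁿ e^{z²/n} converges in ℂ. Consequently the function H(z) = e^{−(1+γ)z²} · ∏_{n=1}^{∞} (1 − z²/n²)ⁿ e^{z²/n}, where γ is the Euler–Mascheroni constant, is well-defined on all of ℂ. -/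
/-- If `n ≥ 2 ‖a‖ + 1`, the regularized factor `(1 - a / n²)ⁿ exp (a / n)` differs from `1` by at
most `2 ‖a‖² / n³`. -/
lemma norm_one_sub_div_sq_pow_mul_exp_sub_one_le {a : ℂ} {n : ℕ} (hn : 2 * ‖a‖ + 1 ≤ n) :
    ‖(1 - a / (n : ℂ) ^ 2) ^ n * Complex.exp (a / (n : ℂ)) - 1‖ ≤ 2 * (‖a‖ ^ 2 / (n : ℝ) ^ 3) := by
  have ha := norm_nonneg a
  have hn1 : (1 : ℝ) ≤ n := by linarith
  have hn0 : (n : ℂ) ≠ 0 := by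
    rintro h
    rw [Nat.cast_eq_zero] at h
    norm_num [h] at hn1
  set w : ℂ := -(a / (n : ℂ) ^ 2) with hw
  have hwn : ‖w‖ = ‖a‖ / (n : ℝ) ^ 2 := by simp [hw]
  have hw2 : ‖w‖ ≤ 1 / 2 := by
    rw [hwn, div_le_iff₀ (by positivity)]
    nlinarith
  have hne : 1 + w ≠ 0 := by
    intro h
    have : w = -1 := by linear_combination h
    norm_num [this] at hw2
  have hexp : (1 - a / (n : ℂ) ^ 2) ^ n * Complex.exp (a / (n : ℂ)) =
      Complex.exp (n * (Complex.log (1 + w) - w)) := by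
    have : (n : ℂ) * (Complex.log (1 + w) - w) = n * Complex.log (1 + w) + a / n := by
      rw [hw]
      field_simp
      ring
    rw [this, Complex.exp_add, Complex.exp_nat_mul, Complex.exp_log hne, hw, ← sub_eq_add_neg]
  have hlog : ‖Complex.log (1 + w) - w‖ ≤ ‖w‖ ^ 2 := by
    refine (Complex.norm_log_one_add_sub_self_le (by linarith)).trans ?_
    have : (1 - ‖w‖)⁻¹ ≤ 2 := inv_le_of_inv_le₀ (by norm_num) (by linarith)
    nlinarith [sq_nonneg ‖w‖]
  have hg : ‖(n : ℂ) * (Complex.log (1 + w) - w)‖ ≤ ‖a‖ ^ 2 / (n : ℝ) ^ 3 := by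
    rw [norm_mul, Complex.norm_natCast]
    calc (n : ℝ) * ‖Complex.log (1 + w) - w‖ ≤ n * ‖w‖ ^ 2 := by gcongr
      _ = ‖a‖ ^ 2 / (n : ℝ) ^ 3 := by
        rw [hwn]
        field_simp
  have hle : ‖a‖ ^ 2 / (n : ℝ) ^ 3 ≤ 1 := by
    rw [div_le_one (by positivity)]
    calc ‖a‖ ^ 2 ≤ (n : ℝ) ^ 2 := by gcongr; linarith
      _ ≤ (n : ℝ) ^ 3 := pow_le_pow_right₀ hn1 (by norm_num)
  rw [hexp]
  exact (Complex.norm_exp_sub_one_le (hg.trans hle)).trans (by gcongr)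

/-- The infinite product defining the one-loop building block
`H(z) = e^{-(1+γ)z²} ∏_{n≥1} (1 - z²/n²)ⁿ e^{z²/n}` converges: for every `z ∈ ℂ`,
the family `n ↦ (1 - z²/n²)ⁿ exp(z²/n)` indexed by the positive integers is multipliable,
so `H` is well-defined on all of `ℂ`. -/
theorem one_loop_H_function_multipliable (z : ℂ) :
    Multipliable fun n : ℕ+ =>
      (1 - z ^ 2 / ((n : ℕ) : ℂ) ^ 2) ^ (n : ℕ) * Complex.exp (z ^ 2 / ((n : ℕ) : ℂ)) := by
  have hs : Summable fun n : ℕ =>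
      ‖(1 - z ^ 2 / (n : ℂ) ^ 2) ^ n * Complex.exp (z ^ 2 / (n : ℂ)) - 1‖ := by
    have hb : Summable fun n : ℕ => 2 * (‖z ^ 2‖ ^ 2 / (n : ℝ) ^ 3) := by
      simp only [div_eq_mul_inv]
      exact ((Real.summable_nat_pow_inv.2 (by norm_num)).mul_left _).mul_left _
    refine hb.of_norm_bounded_eventually_nat ?_
    filter_upwards [tendsto_natCast_atTop_atTop.eventually_ge_atTop (2 * ‖z ^ 2‖ + 1)] with n hn
    rw [norm_norm]
    exact norm_one_sub_div_sq_pow_mul_exp_sub_one_le hn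
  simpa using multipliable_one_add_of_summable (hs.comp_injective PNat.coe_injective)
end
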